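/- arXiv:0905.0573 — 4 statements merged into one kernel-verified Lean document; each statement's English description precedes it below -/
import Mathlib

section
/- Let λ₁, …, λₙ ∈ 𝔻 with max_j |λ_j| ≤ r < 1, B the associated Blaschke product, and f ∈ K_B = H² ⊖ BH² with n ≥ 2. Then ‖f'‖_{H²} ≤ [(1 + (1+r)(n-1) + √(n-2))/(1-r)]·‖f‖_{H²}. -/
open Complex Metric

noncomputable def blaschke7 (l z : ℂ) : ℂ := (l - z) / (1 - (starRingEnd ℂ) l * z)

/-- The Malmquist basis of the model space `K_B`. -/
noncomputable def malmquist7 (n : ℕ) (l : Fin n → ℂ) (k : Fin n) (z : ℂ) : ℂ :=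
  (∏ j ∈ Finset.univ.filter (fun j => j < k), blaschke7 (l j) z) *
    ((Real.sqrt (1 - ‖l k‖ ^ 2) : ℂ) / (1 - (starRingEnd ℂ) (l k) * z))

open Real in
lemma cavg_ofReal7 (g : ℂ → ℝ) :
    ((circleAverage g 0 1 : ℝ) : ℂ) = circleAverage (fun z => (g z : ℂ)) 0 1 := by
  unfold circleAverage
  rw [intervalIntegral.integral_ofReal]
  simp

open Real in
lemma cavg_conj7 (g : ℂ → ℂ) :
    circleAverage (fun z => (starRingEnd ℂ) (g z)) 0 1
      = (starRingEnd ℂ) (circleAverage g 0 1) := by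
  unfold circleAverage
  rw [intervalIntegral.intervalIntegral_conj, Complex.real_smul, Complex.real_smul, map_mul,
    Complex.conj_ofReal]

lemma den_ne7 {l z : ℂ} (h : ‖z‖ * ‖l‖ < 1) : 1 - (starRingEnd ℂ) l * z ≠ 0 := by
  intro h0
  have h1 : (starRingEnd ℂ) l * z = 1 := (sub_eq_zero.1 h0).symm
  have h2 : ‖(starRingEnd ℂ) l * z‖ = 1 := by rw [h1]; simp
  rw [norm_mul, RCLike.norm_conj] at h2
  nlinarith

lemma conj_sphere7 {z : ℂ} (hz : ‖z‖ = 1) : (starRingEnd ℂ) z = z⁻¹ := by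
  rw [Complex.inv_def, Complex.normSq_eq_norm_sq, hz]; simp

lemma sub_ne7 {l z : ℂ} (hl : ‖l‖ < 1) (hz : ‖z‖ = 1) : z - l ≠ 0 := by
  intro h
  rw [sub_eq_zero.1 h] at hz
  linarith

lemma conj_den7 {l z : ℂ} (hz : ‖z‖ = 1) :
    (starRingEnd ℂ) (1 - (starRingEnd ℂ) l * z) = (z - l) / z := by
  have hz0 : z ≠ 0 := by rintro rfl; simp at hz
  simp only [map_sub, map_one, map_mul, Complex.conj_conj, conj_sphere7 hz]
  field_simp

open Real in
lemma repro7 (l : ℂ) (hl : ‖l‖ < 1) (H : ℂ → ℂ) (hH : DifferentiableOn ℂ H (closedBall 0 1)) :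
    circleAverage (fun z => H z * (starRingEnd ℂ) (1 / (1 - (starRingEnd ℂ) l * z))) 0 1
      = H l := by
  have hd : DiffContOnCl ℂ H (ball 0 1) :=
    (hH.mono closure_ball_subset_closedBall).diffContOnCl
  rw [← hd.two_pi_i_inv_smul_circleIntegral_sub_inv_smul (w := l) (by simpa using hl),
    circleAverage_eq_circleIntegral one_ne_zero]
  congr 1
  apply circleIntegral.integral_congr zero_le_one
  intro z hz
  have hz1 : ‖z‖ = 1 := by simpa using hz
  have hz0 : z ≠ 0 := by rintro rfl; simp at hz1
  have := sub_ne7 hl hz1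
  simp only [map_div₀, conj_den7 hz1, smul_eq_mul, sub_zero, map_one]
  field_simp

open Real in
lemma fourth7 (l : ℂ) (hl : ‖l‖ < 1) :
    circleAverage (fun z => (‖1 - (starRingEnd ℂ) l * z‖ ^ 4)⁻¹) 0 1
      = (1 + ‖l‖ ^ 2) / (1 - ‖l‖ ^ 2) ^ 3 := by
  have hU : IsOpen {z : ℂ | 1 - (starRingEnd ℂ) l * z ≠ 0} :=
    isOpen_ne.preimage (by fun_prop : Continuous fun z : ℂ => 1 - (starRingEnd ℂ) l * z)
  have hsub : closedBall (0:ℂ) 1 ⊆ {z : ℂ | 1 - (starRingEnd ℂ) l * z ≠ 0} := by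
    intro z hz
    have : ‖z‖ ≤ 1 := by simpa using hz
    exact den_ne7 (by nlinarith [norm_nonneg l])
  have hdiff : DifferentiableOn ℂ (fun z : ℂ => z / (1 - (starRingEnd ℂ) l * z) ^ 2)
      {z : ℂ | 1 - (starRingEnd ℂ) l * z ≠ 0} := by
    intro z hz
    have : (1 - (starRingEnd ℂ) l * z) ^ 2 ≠ 0 := pow_ne_zero _ hz
    apply DifferentiableAt.differentiableWithinAt
    fun_prop (disch := assumption)
  have h := two_pi_I_inv_smul_circleIntegral_sub_sq_inv_smul_of_differentiable hU hsub hdiff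
    (w₀ := l) (by simpa using hl)
  have hq : (starRingEnd ℂ) l * l = ((‖l‖ ^ 2 : ℝ) : ℂ) := by
    rw [mul_comm, Complex.mul_conj, Complex.normSq_eq_norm_sq]
  have hne : 1 - (starRingEnd ℂ) l * l ≠ 0 := den_ne7 (by nlinarith [norm_nonneg l])
  have hder : HasDerivAt (fun z : ℂ => z / (1 - (starRingEnd ℂ) l * z) ^ 2)
      ((1 + (starRingEnd ℂ) l * l) / (1 - (starRingEnd ℂ) l * l) ^ 3) l := by
    have h1 : HasDerivAt (fun z : ℂ => 1 - (starRingEnd ℂ) l * z) (-((starRingEnd ℂ) l * 1)) l :=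
      ((hasDerivAt_id l).const_mul _).const_sub 1
    convert! (hasDerivAt_id l).div (h1.pow 2) (pow_ne_zero 2 hne) using 1
    simp only [id]
    field_simp
    simp
    ring
  rw [hder.deriv] at h
  rw [← Complex.ofReal_inj, cavg_ofReal7, circleAverage_eq_circleIntegral one_ne_zero]
  push_cast
  push_cast at hq
  rw [hq] at h
  rw [← h]
  congr 1
  apply circleIntegral.integral_congr zero_le_one
  intro z hz
  have hz1 : ‖z‖ = 1 := by simpa using hz
  have hz0 : z ≠ 0 := by rintro rfl; simp at hz1
  have h3 := sub_ne7 hl hz1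
  have h4 : 1 - (starRingEnd ℂ) l * z ≠ 0 := den_ne7 (by rw [hz1]; simpa using hl)
  have h5 : ((‖1 - (starRingEnd ℂ) l * z‖ : ℂ)) ^ 4
      = ((1 - (starRingEnd ℂ) l * z) * ((z - l) / z)) ^ 2 := by
    rw [← conj_den7 hz1, Complex.mul_conj, Complex.normSq_eq_norm_sq]
    push_cast; ring
  simp only [h5, smul_eq_mul, sub_zero]
  field_simp

lemma blaschke_diff7 {l z : ℂ} (h : ‖z‖ * ‖l‖ < 1) : DifferentiableAt ℂ (blaschke7 l) z := by
  have := den_ne7 h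
  unfold blaschke7
  fun_prop (disch := assumption)

lemma malmquist_diff7 {n : ℕ} {l : Fin n → ℂ} {z : ℂ} (h : ∀ j, ‖z‖ * ‖l j‖ < 1) (k : Fin n) :
    DifferentiableAt ℂ (malmquist7 n l k) z := by
  have := den_ne7 (h k)
  unfold malmquist7
  apply DifferentiableAt.mul
  · exact DifferentiableAt.fun_finsetProd fun i _ => blaschke_diff7 (h i)
  · fun_prop (disch := assumption)

lemma norm_den7 {l z : ℂ} (hz : ‖z‖ = 1) : ‖1 - (starRingEnd ℂ) l * z‖ = ‖z - l‖ := by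
  rw [← RCLike.norm_conj, conj_den7 hz, norm_div, hz, div_one]

lemma blaschke_norm7 {l z : ℂ} (hl : ‖l‖ < 1) (hz : ‖z‖ = 1) : ‖blaschke7 l z‖ = 1 := by
  unfold blaschke7
  rw [norm_div, norm_den7 hz, norm_sub_rev, div_self]
  exact norm_ne_zero_iff.2 (sub_ne7 hl hz)

lemma malmquist_norm7 {n : ℕ} {l : Fin n → ℂ} {z : ℂ} (hl : ∀ j, ‖l j‖ < 1) (hz : ‖z‖ = 1)
    (k : Fin n) : ‖malmquist7 n l k z‖
      = Real.sqrt (1 - ‖l k‖ ^ 2) / ‖1 - (starRingEnd ℂ) (l k) * z‖ := by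
  unfold malmquist7
  rw [norm_mul, norm_prod, Finset.prod_eq_one (fun i _ => blaschke_norm7 (hl i) hz), one_mul,
    norm_div, Complex.norm_real, Real.norm_of_nonneg (Real.sqrt_nonneg _)]

lemma blaschke_logDeriv7 {l z : ℂ} (hl : ‖l‖ < 1) (hz : ‖z‖ = 1) :
    ‖logDeriv (blaschke7 l) z‖ ≤ (1 + ‖l‖) / (1 - ‖l‖) := by
  have h4 : 1 - (starRingEnd ℂ) l * z ≠ 0 := den_ne7 (by rw [hz]; simpa using hl)
  have h3 := sub_ne7 hl hz
  have h3' : l - z ≠ 0 := by rw [← neg_sub]; exact neg_ne_zero.2 h3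
  have hq : (starRingEnd ℂ) l * l = ((‖l‖ ^ 2 : ℝ) : ℂ) := by
    rw [mul_comm, Complex.mul_conj, Complex.normSq_eq_norm_sq]
  have h1 : HasDerivAt (fun z : ℂ => 1 - (starRingEnd ℂ) l * z) (-((starRingEnd ℂ) l * 1)) z :=
      ((hasDerivAt_id z).const_mul _).const_sub 1
  have h2 : HasDerivAt (blaschke7 l) _ z := ((hasDerivAt_id z).const_sub l).div h1 h4
  have h5 : logDeriv (blaschke7 l) z
      = ((-(1 - ‖l‖ ^ 2) : ℝ) : ℂ) / ((1 - (starRingEnd ℂ) l * z) * (l - z)) := by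
    rw [logDeriv_apply, h2.deriv]
    unfold blaschke7
    push_cast
    push_cast at hq
    rw [← hq]
    simp only [id]
    field_simp
    ring
  have h6 : 1 - ‖l‖ ≤ ‖l - z‖ := by
    have := norm_sub_norm_le z l
    rw [norm_sub_rev] at this
    linarith
  have h7 : 0 ≤ 1 - ‖l‖ ^ 2 := by nlinarith [norm_nonneg l]
  rw [h5, norm_div, norm_mul, norm_den7 hz, Complex.norm_real, norm_neg, Real.norm_of_nonneg h7,
    norm_sub_rev z l]
  have h8 : 0 < 1 - ‖l‖ := by linarith
  have h9 : 0 < ‖l - z‖ := by linarith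
  rw [div_le_div_iff₀ (by positivity) h8]
  have : (1 - ‖l‖) * (1 - ‖l‖) ≤ ‖l - z‖ * ‖l - z‖ := mul_le_mul h6 h6 h8.le h9.le
  nlinarith [norm_nonneg l]

lemma malmquist_deriv7 {n : ℕ} {l : Fin n → ℂ} {z : ℂ} (hl : ∀ j, ‖l j‖ < 1) (hz : ‖z‖ = 1)
    (k : Fin n) : deriv (malmquist7 n l k) z = malmquist7 n l k z *
      (∑ i ∈ Finset.univ.filter (fun j => j < k), logDeriv (blaschke7 (l i)) z
        + (starRingEnd ℂ) (l k) / (1 - (starRingEnd ℂ) (l k) * z)) := by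
  have hb : ∀ i, blaschke7 (l i) z ≠ 0 := fun i h => by
    have := blaschke_norm7 (hl i) hz
    rw [h] at this; simp at this
  have hlt : ∀ j, ‖z‖ * ‖l j‖ < 1 := fun j => by rw [hz]; simpa using hl j
  have h4 := den_ne7 (hlt k)
  have hs : ((Real.sqrt (1 - ‖l k‖ ^ 2) : ℝ) : ℂ) ≠ 0 := by
    rw [Complex.ofReal_ne_zero]
    refine (Real.sqrt_pos.2 ?_).ne'
    nlinarith [norm_nonneg (l k), hl k]
  have hP : (∏ j ∈ Finset.univ.filter (fun j => j < k), blaschke7 (l j) z) ≠ 0 :=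
    Finset.prod_ne_zero_iff.2 fun i _ => hb i
  have h1 : HasDerivAt (fun z : ℂ => 1 - (starRingEnd ℂ) (l k) * z)
      (-((starRingEnd ℂ) (l k) * 1)) z :=
      ((hasDerivAt_id z).const_mul _).const_sub 1
  have hm : malmquist7 n l k z ≠ 0 := mul_ne_zero hP (div_ne_zero hs h4)
  have hld : logDeriv (malmquist7 n l k) z =
      (∑ i ∈ Finset.univ.filter (fun j => j < k), logDeriv (blaschke7 (l i)) z
        + (starRingEnd ℂ) (l k) / (1 - (starRingEnd ℂ) (l k) * z)) := by
    unfold malmquist7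
    rw [logDeriv_mul (f := fun z => ∏ j ∈ Finset.univ.filter (fun j => j < k), blaschke7 (l j) z)
      (g := fun z => (Real.sqrt (1 - ‖l k‖ ^ 2) : ℂ) / (1 - (starRingEnd ℂ) (l k) * z)) z hP (div_ne_zero hs h4)
      (DifferentiableAt.fun_finsetProd fun i _ => blaschke_diff7 (hlt i))
      (by fun_prop (disch := assumption)), logDeriv_prod (fun i _ => hb i)
      (fun i _ => blaschke_diff7 (hlt i)), logDeriv_div z hs h4 (by fun_prop) (by fun_prop)]
    congr 1
    rw [logDeriv_const, logDeriv_apply, h1.deriv]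
    simp
    ring
  rw [← hld, logDeriv_apply]
  field_simp
open Real in
lemma ortho_le7 {n : ℕ} {l : Fin n → ℂ} (hl : ∀ j, ‖l j‖ < 1) {j k : Fin n} (hjk : j ≤ k) :
    circleAverage (fun z => malmquist7 n l k z * (starRingEnd ℂ) (malmquist7 n l j z)) 0 1
      = if k = j then 1 else 0 := by
  set sk : ℂ := ((Real.sqrt (1 - ‖l k‖ ^ 2) : ℝ) : ℂ) with hsk
  set sj : ℂ := ((Real.sqrt (1 - ‖l j‖ ^ 2) : ℝ) : ℂ) with hsj
  let H : ℂ → ℂ := fun z => (∏ i ∈ Finset.univ.filter (fun i => j ≤ i ∧ i < k), blaschke7 (l i) z) *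
    (sk * sj / (1 - (starRingEnd ℂ) (l k) * z))
  have hH : DifferentiableOn ℂ H (closedBall 0 1) := by
    intro z hz
    have hz1 : ‖z‖ ≤ 1 := by simpa using hz
    have hlt : ∀ j, ‖z‖ * ‖l j‖ < 1 := fun j => by nlinarith [norm_nonneg (l j), hl j]
    have := den_ne7 (hlt k)
    apply DifferentiableAt.differentiableWithinAt
    apply DifferentiableAt.mul
    · exact DifferentiableAt.fun_finsetProd fun i _ => blaschke_diff7 (hlt i)
    · fun_prop (disch := assumption)
  have h1 : circleAverage (fun z => malmquist7 n l k z * (starRingEnd ℂ) (malmquist7 n l j z)) 0 1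
      = circleAverage (fun z => H z * (starRingEnd ℂ) (1 / (1 - (starRingEnd ℂ) (l j) * z))) 0 1 := by
    apply circleAverage_congr_sphere
    intro z hz
    have hz1 : ‖z‖ = 1 := by simpa using hz
    have hsplit : (∏ i ∈ Finset.univ.filter (fun i => i < k), blaschke7 (l i) z)
        = (∏ i ∈ Finset.univ.filter (fun i => i < j), blaschke7 (l i) z) *
          ∏ i ∈ Finset.univ.filter (fun i => j ≤ i ∧ i < k), blaschke7 (l i) z := by
      rw [← Finset.prod_union]
      · congr 1
        ext i
        simp only [Finset.mem_filter, Finset.mem_univ, true_and, Finset.mem_union]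
        omega
      · rw [Finset.disjoint_filter]
        intro i _ h1 h2
        omega
    have hone : (∏ i ∈ Finset.univ.filter (fun i => i < j), blaschke7 (l i) z) *
        (starRingEnd ℂ) (∏ i ∈ Finset.univ.filter (fun i => i < j), blaschke7 (l i) z) = 1 := by
      rw [Complex.mul_conj, Complex.normSq_eq_norm_sq, norm_prod,
        Finset.prod_eq_one (fun i _ => blaschke_norm7 (hl i) hz1)]
      simp
    simp only [H, malmquist7]
    rw [hsplit, map_mul, map_div₀, map_div₀, ← hsk, ← hsj, map_one]
    have hc : (starRingEnd ℂ) sj = sj := Complex.conj_ofReal _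
    rw [hc]
    linear_combination (∏ i ∈ Finset.univ.filter (fun i => j ≤ i ∧ i < k), blaschke7 (l i) z) *
      (sk / (1 - (starRingEnd ℂ) (l k) * z)) *
      (sj / (starRingEnd ℂ) (1 - (starRingEnd ℂ) (l j) * z)) * hone
  rw [h1, repro7 (l j) (hl j) H hH]
  split_ifs with h
  · subst h
    have hq : (starRingEnd ℂ) (l k) * l k = ((‖l k‖ ^ 2 : ℝ) : ℂ) := by
      rw [mul_comm, Complex.mul_conj, Complex.normSq_eq_norm_sq]
    have h0 : 0 < 1 - ‖l k‖ ^ 2 := by nlinarith [norm_nonneg (l k), hl k]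
    have hss : sk * sj = ((1 - ‖l k‖ ^ 2 : ℝ) : ℂ) := by
      rw [hsk, hsj, ← Complex.ofReal_mul, Real.mul_self_sqrt h0.le]
    have he : Finset.univ.filter (fun i => k ≤ i ∧ i < k) = ∅ := by
      ext i; simp
    simp only [H]
    rw [he, hss, hq, Finset.prod_empty, one_mul]
    have h1 : ((1 - ‖l k‖ ^ 2 : ℝ) : ℂ) ≠ 0 := Complex.ofReal_ne_zero.2 h0.ne'
    push_cast at h1 ⊢
    exact div_self h1
  · simp only [H]
    rw [Finset.prod_eq_zero (i := j), zero_mul]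
    · simp only [Finset.mem_filter, Finset.mem_univ, true_and, le_refl]
      omega
    · simp [blaschke7]

open Real in
lemma ortho7 {n : ℕ} {l : Fin n → ℂ} (hl : ∀ j, ‖l j‖ < 1) (j k : Fin n) :
    circleAverage (fun z => malmquist7 n l k z * (starRingEnd ℂ) (malmquist7 n l j z)) 0 1
      = if k = j then 1 else 0 := by
  rcases le_total j k with h | h
  · exact ortho_le7 hl h
  · have h1 := ortho_le7 hl h
    have h2 := cavg_conj7 (fun z => malmquist7 n l j z * (starRingEnd ℂ) (malmquist7 n l k z))
    rw [h1] at h2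
    simp only [map_mul, Complex.conj_conj] at h2
    simp only [mul_comm (malmquist7 n l k _)]
    simp only [mul_comm ((starRingEnd ℂ) _)] at h2
    simp only [mul_comm ((starRingEnd ℂ) _)]
    rw [h2]
    by_cases hjk : j = k
    · simp [hjk]
    · simp [hjk, Ne.symm hjk]

lemma malmquist_cont7 {n : ℕ} {l : Fin n → ℂ} (hl : ∀ j, ‖l j‖ < 1) (k : Fin n) :
    ContinuousOn (malmquist7 n l k) (sphere 0 1) := by
  intro z hz
  have hz1 : ‖z‖ = 1 := by simpa using hz
  exact (malmquist_diff7 (fun j => by rw [hz1]; simpa using hl j) k).continuousAt.continuousWithinAt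

open Real in
lemma parseval7 {n : ℕ} {l : Fin n → ℂ} (hl : ∀ j, ‖l j‖ < 1) (c : Fin n → ℂ)
    (T : Finset (Fin n)) :
    circleAverage (fun z => ‖∑ k ∈ T, c k * malmquist7 n l k z‖ ^ 2) 0 1
      = ∑ k ∈ T, ‖c k‖ ^ 2 := by
  rw [← Complex.ofReal_inj, cavg_ofReal7]
  have h1 : ∀ z : ℂ, ((‖∑ k ∈ T, c k * malmquist7 n l k z‖ ^ 2 : ℝ) : ℂ)
      = ∑ k ∈ T, ∑ j ∈ T, (c k * (starRingEnd ℂ) (c j)) •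
        (malmquist7 n l k z * (starRingEnd ℂ) (malmquist7 n l j z)) := by
    intro z
    rw [← Complex.normSq_eq_norm_sq, ← Complex.mul_conj, map_sum, Finset.sum_mul_sum]
    refine Finset.sum_congr rfl fun k _ => Finset.sum_congr rfl fun j _ => ?_
    rw [map_mul, smul_eq_mul]; ring
  have hcont : ∀ k j, ContinuousOn (fun z => (c k * (starRingEnd ℂ) (c j)) •
        (malmquist7 n l k z * (starRingEnd ℂ) (malmquist7 n l j z))) (sphere 0 1) := by
    intro k j
    have h2 := (malmquist_cont7 hl k).mul
      (Complex.continuous_conj.comp_continuousOn (malmquist_cont7 hl j))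
    exact h2.const_smul (c k * (starRingEnd ℂ) (c j))
  simp only [h1]
  rw [circleAverage_fun_sum (fun k _ => ContinuousOn.circleIntegrable zero_le_one
    (continuousOn_finsetSum _ fun j _ => hcont k j))]
  push_cast
  refine Finset.sum_congr rfl fun k hk => ?_
  rw [circleAverage_fun_sum (fun j _ => ContinuousOn.circleIntegrable zero_le_one (hcont k j))]
  simp only [circleAverage_fun_smul, ortho7 hl]
  rw [Finset.sum_eq_single k]
  · simp [Complex.mul_conj, Complex.normSq_eq_norm_sq]
  · intro j _ hjk; simp [Ne.symm hjk]
  · intro h; exact absurd hk h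
open Real in
lemma cavg_eq7 (g : ℂ → ℂ) :
    (1 / (2 * Real.pi)) * ∫ θ in (0:ℝ)..(2 * Real.pi), ‖g (Complex.exp (θ * Complex.I))‖ ^ 2
      = circleAverage (fun z => ‖g z‖ ^ 2) 0 1 := by
  simp [circleAverage, circleMap]

lemma two_term7 {a v p q b : ℝ} (hp : 0 < p) (hb : 0 < b) (h : a ^ 2 ≤ p * q) :
    (a + v) ^ 2 ≤ (p + b) * (q + v ^ 2 / b) := by
  obtain ⟨w, rfl⟩ : ∃ w, v = b * w := ⟨v / b, by field_simp⟩
  have h1 : (b * w) ^ 2 / b = b * w ^ 2 := by field_simp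
  rw [h1]
  have h2 : 0 ≤ q + p * w ^ 2 - 2 * a * w := by
    have : 0 ≤ p * (q + p * w ^ 2 - 2 * a * w) := by nlinarith [sq_nonneg (p * w - a)]
    exact nonneg_of_mul_nonneg_right this hp
  nlinarith [mul_nonneg hb.le h2]

/-- Bound for the fourth-moment constants. -/
lemma rho_bound7 {t r : ℝ} (h0 : 0 ≤ t) (htr : t ≤ r) (hr : r < 1) :
    t ^ 2 * (1 - t ^ 2) * ((1 + t ^ 2) / (1 - t ^ 2) ^ 3) ≤ 1 / 2 / (1 - r) ^ 2 := by
  have h1 : 0 < 1 - t := by linarith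
  have h2 : 0 < 1 - t ^ 2 := by nlinarith
  have h3 : t ^ 2 * (1 - t ^ 2) * ((1 + t ^ 2) / (1 - t ^ 2) ^ 3)
      = t ^ 2 * (1 + t ^ 2) / (1 + t) ^ 2 / (1 - t) ^ 2 := by
    have h4 : 1 - t ^ 2 = (1 - t) * (1 + t) := by ring
    rw [h4]
    have : 0 < 1 + t := by linarith
    field_simp
  rw [h3]
  have h5 : t ^ 2 * (1 + t ^ 2) / (1 + t) ^ 2 ≤ 1 / 2 := by
    rw [div_le_div_iff₀ (by positivity) (by norm_num)]
    have a1 : t ^ 2 ≤ 1 := by nlinarith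
    have a2 : t ^ 4 ≤ t := by
      have : t ^ 4 = t * t * t ^ 2 := by ring
      nlinarith [mul_nonneg h0 h0]
    nlinarith
  have h6 : 0 < 1 - r := by linarith
  gcongr

/-- the refined Bernstein-type inequality
`‖f'‖_{H²} ≤ [(1 + (1+r)(n-1) + √(n-2))/(1-r)] ‖f‖_{H²}` for `f ∈ K_B`, `n ≥ 2`. -/
theorem stmt_7 (n : ℕ) (hn : 2 ≤ n) (l : Fin n → ℂ) (r : ℝ) (hr0 : 0 ≤ r)
    (hr : r < 1) (hl : ∀ j, ‖l j‖ ≤ r) (f : ℂ → ℂ) (c : Fin n → ℂ)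
    (hf : ∀ z : ℂ, ‖z‖ * r < 1 → f z = ∑ k, c k * malmquist7 n l k z) :
    Real.sqrt ((1 / (2 * Real.pi)) *
        ∫ θ in (0:ℝ)..(2 * Real.pi),
          ‖deriv f (Complex.exp (θ * Complex.I))‖ ^ 2) ≤
      ((1 + (1 + r) * ((n : ℝ) - 1) + Real.sqrt ((n : ℝ) - 2)) / (1 - r)) *
        Real.sqrt ((1 / (2 * Real.pi)) *
          ∫ θ in (0:ℝ)..(2 * Real.pi),
            ‖f (Complex.exp (θ * Complex.I))‖ ^ 2) := by
  have hl1 : ∀ j, ‖l j‖ < 1 := fun j => (hl j).trans_lt hr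
  have h1r : 0 < 1 - r := by linarith
  have hn2 : (2 : ℝ) ≤ n := by exact_mod_cast hn
  rw [cavg_eq7, cavg_eq7]
  -- the open set on which everything is holomorphic
  have hU : IsOpen {z : ℂ | ‖z‖ * r < 1} :=
    isOpen_lt (by fun_prop) continuous_const
  have hzU : ∀ z : ℂ, ‖z‖ = 1 → z ∈ {z : ℂ | ‖z‖ * r < 1} := by
    intro z hz
    simp only [Set.mem_ofPred_eq, hz, one_mul, hr]
  have hdm : ∀ z ∈ {z : ℂ | ‖z‖ * r < 1}, ∀ k, DifferentiableAt ℂ (malmquist7 n l k) z := by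
    intro z hz k
    refine malmquist_diff7 (fun j => ?_) k
    have : ‖z‖ * ‖l j‖ ≤ ‖z‖ * r := mul_le_mul_of_nonneg_left (hl j) (norm_nonneg _)
    exact this.trans_lt hz
  have hfd : DifferentiableOn ℂ f {z : ℂ | ‖z‖ * r < 1} := by
    have : DifferentiableOn ℂ (fun z => ∑ k, c k * malmquist7 n l k z) {z : ℂ | ‖z‖ * r < 1} :=
      fun z hz => (DifferentiableAt.fun_sum fun k _ =>
        (hdm z hz k).const_mul (c k)).differentiableWithinAt
    exact this.congr fun z hz => hf z hz
  have hcd : ContinuousOn (deriv f) (sphere 0 1) :=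
    (hfd.deriv hU).continuousOn.mono fun z hz => hzU z (by simpa using hz)
  set M2 : ℝ := ∑ k, ‖c k‖ ^ 2 with hM2
  have hM0 : 0 ≤ M2 := Finset.sum_nonneg fun k _ => by positivity
  have hfM : Real.circleAverage (fun z => ‖f z‖ ^ 2) 0 1 = M2 := by
    rw [hM2, ← parseval7 hl1 c Finset.univ]
    apply Real.circleAverage_congr_sphere
    intro z hz
    simp only
    rw [hf z (hzU z (by simpa using hz))]
  rw [hfM]
  set κ : ℝ := (1 + r) / (1 - r) with hκ
  set β : ℝ := (1 + Real.sqrt ((n : ℝ) - 2)) / (1 - r) with hβ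
  have hκ0 : 0 < κ := by positivity
  have hβ0 : 0 < β := by positivity
  have hcoef : (1 + (1 + r) * ((n : ℝ) - 1) + Real.sqrt ((n : ℝ) - 2)) / (1 - r)
      = κ * ((n : ℝ) - 1) + β := by
    rw [hκ, hβ]; field_simp; ring
  rw [hcoef]
  set W : ℝ := κ * ((n : ℝ) - 1) + β with hW
  have hp0 : 0 < κ * ((n : ℝ) - 1) := mul_pos hκ0 (by linarith)
  have hW0 : 0 < W := by positivity
  let S : Finset (Fin n) := Finset.univ.erase ⟨n - 1, by omega⟩
  have hScard : (S.card : ℝ) = (n : ℝ) - 1 := by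
    simp only [S]
    rw [Finset.card_erase_of_mem (Finset.mem_univ _), Finset.card_univ, Fintype.card_fin,
      Nat.cast_sub (by omega)]
    simp
  let T : Fin n → Finset (Fin n) := fun i => Finset.univ.filter (fun k => i < k)
  let G : Fin n → ℂ → ℂ := fun i z => ∑ k ∈ T i, c k * malmquist7 n l k z
  let Q : ℂ → ℝ := fun z => ∑ k, (‖l k‖ ^ 2 * (1 - ‖l k‖ ^ 2)) •
    (‖1 - (starRingEnd ℂ) (l k) * z‖ ^ 4)⁻¹
  let V : ℂ → ℂ := fun z => ∑ k, c k * (malmquist7 n l k z *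
    ((starRingEnd ℂ) (l k) / (1 - (starRingEnd ℂ) (l k) * z)))
  have hder : ∀ z : ℂ, ‖z‖ = 1 → deriv f z
      = ∑ i ∈ S, logDeriv (blaschke7 (l i)) z * G i z + V z := by
    intro z hz
    have he : f =ᶠ[nhds z] fun z => ∑ k, c k * malmquist7 n l k z := by
      filter_upwards [hU.mem_nhds (hzU z hz)] with w hw using hf w hw
    rw [he.deriv_eq, deriv_fun_sum fun k _ => (hdm z (hzU z hz) k).const_mul (c k)]
    have h1 : ∀ k, deriv (fun z => c k * malmquist7 n l k z) z
        = ∑ i, (if i < k then logDeriv (blaschke7 (l i)) z * (c k * malmquist7 n l k z) else 0)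
          + c k * (malmquist7 n l k z *
            ((starRingEnd ℂ) (l k) / (1 - (starRingEnd ℂ) (l k) * z))) := by
      intro k
      rw [deriv_const_mul _ (hdm z (hzU z hz) k), malmquist_deriv7 hl1 hz, ← Finset.sum_filter,
        ← Finset.sum_mul]
      ring
    rw [Finset.sum_congr rfl fun k _ => h1 k, Finset.sum_add_distrib, Finset.sum_comm]
    congr 1
    rw [← Finset.sum_erase (Finset.univ) (a := (⟨n - 1, by omega⟩ : Fin n))]
    · refine Finset.sum_congr rfl fun i _ => ?_
      rw [← Finset.sum_filter, Finset.mul_sum]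
    · refine Finset.sum_eq_zero fun k _ => if_neg ?_
      intro h
      have h2 : n - 1 < k.val := h
      omega
  have hV : ∀ z : ℂ, ‖z‖ = 1 → ‖V z‖ ^ 2 ≤ M2 * Q z := by
    intro z hz
    have h1 : ‖V z‖ ≤ ∑ k, ‖c k‖ * ‖malmquist7 n l k z *
        ((starRingEnd ℂ) (l k) / (1 - (starRingEnd ℂ) (l k) * z))‖ := by
      refine (norm_sum_le _ _).trans (le_of_eq ?_)
      exact Finset.sum_congr rfl fun k _ => norm_mul _ _
    refine (pow_le_pow_left₀ (norm_nonneg _) h1 2).trans ?_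
    refine (Finset.sum_mul_sq_le_sq_mul_sq _ _ _).trans (le_of_eq ?_)
    congr 1
    refine Finset.sum_congr rfl fun k _ => ?_
    have h0 : 0 ≤ 1 - ‖l k‖ ^ 2 := by nlinarith [norm_nonneg (l k), hl1 k]
    rw [norm_mul, malmquist_norm7 hl1 hz, norm_div, RCLike.norm_conj, mul_pow, div_pow, div_pow,
      Real.sq_sqrt h0, smul_eq_mul]
    have : ‖1 - (starRingEnd ℂ) (l k) * z‖ ≠ 0 :=
      norm_ne_zero_iff.2 (den_ne7 (by rw [hz]; simpa using hl1 k))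
    field_simp
  have hpt : ∀ z : ℂ, ‖z‖ = 1 → ‖deriv f z‖ ^ 2
      ≤ W * (∑ i ∈ S, κ * ‖G i z‖ ^ 2 + (M2 / β) * Q z) := by
    intro z hz
    have h1 : ‖deriv f z‖ ≤ ∑ i ∈ S, κ * ‖G i z‖ + ‖V z‖ := by
      rw [hder z hz]
      refine (norm_add_le _ _).trans ?_
      gcongr
      refine (norm_sum_le _ _).trans ?_
      refine Finset.sum_le_sum fun i _ => ?_
      rw [norm_mul]
      gcongr
      refine (blaschke_logDeriv7 (hl1 i) hz).trans ?_
      have := hl i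
      have := hl1 i
      rw [hκ]
      gcongr
    have h2 : (∑ i ∈ S, κ * ‖G i z‖) ^ 2
        ≤ (κ * ((n : ℝ) - 1)) * ∑ i ∈ S, κ * ‖G i z‖ ^ 2 := by
      have := Finset.sum_sq_le_sum_mul_sum_of_sq_le_mul S (r := fun i => κ * ‖G i z‖)
        (f := fun _ => κ) (g := fun i => κ * ‖G i z‖ ^ 2) (fun i _ => hκ0.le)
        (fun i _ => by positivity) (fun i _ => le_of_eq (by ring))
      rw [Finset.sum_const, nsmul_eq_mul, hScard, mul_comm _ κ] at this
      exact this
    refine (pow_le_pow_left₀ (norm_nonneg _) h1 2).trans ?_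
    refine (two_term7 hp0 hβ0 h2).trans ?_
    rw [hW]
    have h3 : ‖V z‖ ^ 2 / β ≤ M2 / β * Q z := by
      rw [div_mul_eq_mul_div]
      exact div_le_div_of_nonneg_right (hV z hz) hβ0.le
    gcongr
  -- continuity
  have hGc : ∀ i, ContinuousOn (fun z => ‖G i z‖ ^ 2) (sphere 0 1) := fun i =>
    (continuousOn_finsetSum _ fun k _ =>
      continuousOn_const.mul (malmquist_cont7 hl1 k)).norm.pow 2
  have hqc : ∀ k, ContinuousOn (fun z => (‖l k‖ ^ 2 * (1 - ‖l k‖ ^ 2)) •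
      (‖1 - (starRingEnd ℂ) (l k) * z‖ ^ 4)⁻¹) (sphere 0 1) := by
    intro k
    apply ContinuousOn.fun_const_smul
    apply ContinuousOn.inv₀ (by fun_prop)
    intro z hz
    have hz1 : ‖z‖ = 1 := by simpa using hz
    exact pow_ne_zero _ (norm_ne_zero_iff.2 (den_ne7 (by rw [hz1]; simpa using hl1 k)))
  have hQc : ContinuousOn Q (sphere 0 1) := continuousOn_finsetSum _ fun k _ => hqc k
  have hGi : ∀ i, Real.circleAverage (fun z => κ • ‖G i z‖ ^ 2) 0 1 ≤ κ * M2 := by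
    intro i
    rw [Real.circleAverage_fun_smul, smul_eq_mul, parseval7 hl1]
    gcongr
    exact Finset.sum_le_sum_of_subset_of_nonneg (Finset.subset_univ _) fun _ _ _ => by positivity
  have hQi : Real.circleAverage Q 0 1 ≤ β ^ 2 := by
    simp only [Q]
    rw [Real.circleAverage_fun_sum fun k _ =>
      ContinuousOn.circleIntegrable zero_le_one (hqc k)]
    have h1 : ∀ k ∈ (Finset.univ : Finset (Fin n)), Real.circleAverage (fun z =>
        (‖l k‖ ^ 2 * (1 - ‖l k‖ ^ 2)) • (‖1 - (starRingEnd ℂ) (l k) * z‖ ^ 4)⁻¹) 0 1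
        ≤ 1 / 2 / (1 - r) ^ 2 := by
      intro k _
      rw [Real.circleAverage_fun_smul, fourth7 _ (hl1 k), smul_eq_mul]
      exact rho_bound7 (norm_nonneg _) (hl k) hr
    refine (Finset.sum_le_sum h1).trans ?_
    rw [Finset.sum_const, Finset.card_univ, Fintype.card_fin, nsmul_eq_mul, hβ, div_pow,
      ← mul_div_assoc]
    have h2 : Real.sqrt ((n : ℝ) - 2) ^ 2 = (n : ℝ) - 2 := Real.sq_sqrt (by linarith)
    have h3 := Real.sqrt_nonneg ((n : ℝ) - 2)
    gcongr
    nlinarith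
  have hmain : Real.circleAverage (fun z => ‖deriv f z‖ ^ 2) 0 1 ≤ W ^ 2 * M2 := by
    have hsumc : ContinuousOn (fun z => ∑ i ∈ S, κ • ‖G i z‖ ^ 2) (sphere 0 1) :=
      continuousOn_finsetSum _ fun i _ => (hGc i).const_smul κ
    have hQc' : ContinuousOn (fun z => (M2 / β) • Q z) (sphere 0 1) := hQc.const_smul (M2 / β)
    calc Real.circleAverage (fun z => ‖deriv f z‖ ^ 2) 0 1
        ≤ Real.circleAverage
            (fun z => W • (∑ i ∈ S, κ • ‖G i z‖ ^ 2 + (M2 / β) • Q z)) 0 1 := by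
          apply Real.circleAverage_mono
          · exact ContinuousOn.circleIntegrable zero_le_one (hcd.norm.pow 2)
          · exact ContinuousOn.circleIntegrable zero_le_one ((hsumc.add hQc').const_smul W)
          · intro z hz
            exact hpt z (by simpa using hz)
      _ = W * (∑ i ∈ S, Real.circleAverage (fun z => κ • ‖G i z‖ ^ 2) 0 1
            + (M2 / β) * Real.circleAverage Q 0 1) := by
          rw [Real.circleAverage_fun_smul, Real.circleAverage_fun_add
            (ContinuousOn.circleIntegrable zero_le_one hsumc)
            (ContinuousOn.circleIntegrable zero_le_one hQc'),
            Real.circleAverage_fun_smul, Real.circleAverage_fun_sum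
            (f := fun i z => κ • ‖G i z‖ ^ 2) (fun i _ => ContinuousOn.circleIntegrable zero_le_one ((hGc i).const_smul κ))]
          simp only [smul_eq_mul]
      _ ≤ W * (∑ i ∈ S, κ * M2 + (M2 / β) * β ^ 2) := by
          gcongr with i _
          exact hGi i
      _ = W ^ 2 * M2 := by
          rw [Finset.sum_const, nsmul_eq_mul, hScard, hW]
          field_simp
  calc Real.sqrt (Real.circleAverage (fun z => ‖deriv f z‖ ^ 2) 0 1)
      ≤ Real.sqrt (W ^ 2 * M2) := Real.sqrt_le_sqrt hmain
    _ = W * Real.sqrt M2 := by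
        rw [Real.sqrt_mul (by positivity), Real.sqrt_sq hW0.le]
end

section
/- Let σ = {λ₁,…,λₙ} ⊂ 𝔻 be a finite set and f ∈ H² with ‖f‖_{H²} ≤ 1. Then there exists g ∈ H^∞ such that g - f ∈ B_σ H² (i.e., g interpolates f at σ with multiplicities) and ‖g‖_∞ ≤ sup_{ζ∈𝕋} (∑_{k=1}^n (1-|λ_k|²)/|ζ - λ_k|²)^{1/2}. -/
open Complex Metric

noncomputable def blaschke8 (l z : ℂ) : ℂ := (l - z) / (1 - (starRingEnd ℂ) l * z)

noncomputable def finBlaschke8 (n : ℕ) (l : Fin n → ℂ) (z : ℂ) : ℂ :=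
  ∏ j, blaschke8 (l j) z

/-- `f` belongs to the Hardy space `H²` of the unit disc, with `H²` norm at
most `M`: `f` is holomorphic on `𝔻` and all its `L²` circle means are `≤ M²`. -/
def MemH2le8 (f : ℂ → ℂ) (M : ℝ) : Prop :=
  DifferentiableOn ℂ f (ball (0:ℂ) 1) ∧
    ∀ ρ : ℝ, 0 ≤ ρ → ρ < 1 →
      (1 / (2 * Real.pi)) *
          ∫ θ in (0:ℝ)..(2 * Real.pi),
            ‖f ((ρ : ℂ) * Complex.exp (θ * Complex.I))‖ ^ 2 ≤ M ^ 2

open Real (circleAverage)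

theorem h8_cont {F : ℂ → ℂ} (hF : DifferentiableOn ℂ F (ball (0:ℂ) 1)) {w : ℂ} (hw : ‖w‖ < 1) :
    Continuous fun θ : ℝ => F (w * circleMap 0 1 θ) := by
  refine hF.continuousOn.comp_continuous (by fun_prop) fun θ => ?_
  simpa using hw

theorem h8_avg {F : ℂ → ℂ} (r : ℝ) : circleAverage (fun z => ‖F z‖ ^ 2) 0 r
    = (2 * Real.pi)⁻¹ * ∫ θ in (0:ℝ)..(2 * Real.pi), ‖F (r * circleMap 0 1 θ)‖ ^ 2 := by
  simp [circleAverage, circleMap]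

theorem h8_rot {F : ℂ → ℂ} (w : ℂ) :
    (∫ θ in (0:ℝ)..(2 * Real.pi), ‖F (w * circleMap 0 1 θ)‖ ^ 2)
    = ∫ θ in (0:ℝ)..(2 * Real.pi), ‖F (‖w‖ * circleMap 0 1 θ)‖ ^ 2 := by
  have h1 := h8_avg (F := F) ‖w‖
  rw [Real.circleAverage_eq_integral_add w.arg] at h1
  have hpi : (2 * Real.pi)⁻¹ ≠ 0 := by positivity
  have h2 := mul_left_cancel₀ hpi h1
  rw [← h2]
  congr 1
  ext θ
  congr 3
  have h3 := Complex.norm_mul_exp_arg_mul_I w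
  calc w * circleMap 0 1 θ = (‖w‖ * Complex.exp (w.arg * I)) * circleMap 0 1 θ := by rw [h3]
    _ = _ := by
      simp only [circleMap, add_mul, Complex.exp_add, Complex.ofReal_add, Complex.ofReal_one]
      ring

theorem h8_diff {F : ℂ → ℂ} (hF : DifferentiableOn ℂ F (ball (0:ℂ) 1)) (u : ℝ → ℂ)
    (hu : Continuous u) :
    DifferentiableOn ℂ (fun w => ∫ θ in (0:ℝ)..(2 * Real.pi), u θ * F (w * circleMap 0 1 θ))
      (ball (0:ℂ) 1) := by
  intro w hw
  have hw1 : ‖w‖ < 1 := by simpa using hw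
  obtain ⟨R, hwR, hR1⟩ := exists_between hw1
  have hdF : DifferentiableOn ℂ (deriv F) (ball (0:ℂ) 1) := hF.deriv isOpen_ball
  obtain ⟨C, hC⟩ := (isCompact_closedBall (0:ℂ) R).exists_bound_of_continuousOn
    (hdF.continuousOn.mono (closedBall_subset_ball hR1))
  have key := intervalIntegral.hasDerivAt_integral_of_dominated_loc_of_deriv_le
    (μ := MeasureTheory.volume) (a := 0) (b := 2 * Real.pi)
    (F := fun w θ => u θ * F (w * circleMap 0 1 θ))
    (F' := fun w θ => u θ * (deriv F (w * circleMap 0 1 θ) * circleMap 0 1 θ))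
    (x₀ := w) (s := ball 0 R) (bound := fun θ => ‖u θ‖ * C)
    (isOpen_ball.mem_nhds (by simpa using hwR)) ?_ ?_ ?_ ?_ ?_ ?_
  · exact key.2.differentiableAt.differentiableWithinAt
  · filter_upwards [isOpen_ball.mem_nhds hw] with x hx
    exact (hu.mul (h8_cont hF (by simpa using hx))).aestronglyMeasurable
  · exact (hu.mul (h8_cont hF hw1)).intervalIntegrable _ _
  · exact (hu.mul ((h8_cont hdF hw1).mul (by fun_prop))).aestronglyMeasurable
  · refine Filter.Eventually.of_forall fun t _ x hx => ?_
    have hx' : ‖x‖ < R := by simpa using hx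
    have := hC (x * circleMap 0 1 t) (by simpa using hx'.le)
    simp only [norm_mul, norm_circleMap_zero, abs_one, mul_one]
    gcongr
  · exact (by fun_prop : Continuous fun θ => ‖u θ‖ * C).intervalIntegrable _ _
  · refine Filter.Eventually.of_forall fun t _ x hx => ?_
    have hx' : ‖x‖ < R := by simpa using hx
    have hm : x * circleMap 0 1 t ∈ ball (0:ℂ) 1 := by simpa using hx'.trans hR1
    have h1 : HasDerivAt F (deriv F (x * circleMap 0 1 t)) (x * circleMap 0 1 t) :=
      (hF.differentiableAt (isOpen_ball.mem_nhds hm)).hasDerivAt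
    have h2 : HasDerivAt (fun x => x * circleMap 0 1 t) (circleMap 0 1 t) x := by
      simpa using (hasDerivAt_id x).mul_const (circleMap 0 1 t)
    exact (h1.comp x h2).const_mul _

theorem h8_mono {F : ℂ → ℂ} (hF : DifferentiableOn ℂ F (ball (0:ℂ) 1)) {r R : ℝ}
    (hr : 0 ≤ r) (hrR : r ≤ R) (hR : R < 1) :
    circleAverage (fun z => ‖F z‖ ^ 2) 0 r ≤ circleAverage (fun z => ‖F z‖ ^ 2) 0 R := by
  rcases hrR.eq_or_lt with rfl | hlt
  · rfl
  rw [h8_avg, h8_avg]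
  gcongr ?_ * ?_
  have hr1 : ‖(r:ℂ)‖ < 1 := by simpa [abs_of_nonneg hr] using hlt.trans hR
  have hcr := h8_cont hF hr1
  set u : ℝ → ℂ := fun θ => (starRingEnd ℂ) (F (r * circleMap 0 1 θ)) with hu
  have huc : Continuous u := Complex.continuous_conj.comp hcr
  have hd := h8_diff hF u huc
  set I : ℝ → ℝ := fun r => ∫ θ in (0:ℝ)..(2 * Real.pi), ‖F (r * circleMap 0 1 θ)‖ ^ 2 with hI
  change I r ≤ I R
  have hR0 : 0 < R := hr.trans_lt hlt
  have hpi : (0:ℝ) ≤ 2 * Real.pi := by positivity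
  have hmax := Complex.norm_le_of_forall_mem_frontier_norm_le (U := ball (0:ℂ) R) isBounded_ball
    (f := fun w => ∫ θ in (0:ℝ)..(2 * Real.pi), u θ * F (w * circleMap 0 1 θ))
    (C := (I r + I R) / 2) (z := (r:ℂ)) ?_ ?_ ?_
  · have : (∫ θ in (0:ℝ)..(2 * Real.pi), u θ * F (r * circleMap 0 1 θ)) = ((I r : ℝ) : ℂ) := by
      rw [hI, ← intervalIntegral.integral_ofReal]
      congr 1
      ext θ
      simp [hu, Complex.conj_mul']
    simp only [this] at hmax
    have h3 := (le_abs_self (I r)).trans ((Complex.norm_real (I r)).ge.trans hmax)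
    linarith
  · refine DifferentiableOn.diffContOnCl (hd.mono ?_)
    rw [closure_ball _ hR0.ne']
    exact closedBall_subset_ball hR
  · intro z hz
    rw [frontier_ball _ hR0.ne'] at hz
    have hzR : ‖z‖ = R := by simpa using hz
    have hz1 : ‖z‖ < 1 := hzR ▸ hR
    have hcz := h8_cont hF hz1
    have e1 : I R = ∫ θ in (0:ℝ)..(2 * Real.pi), ‖F (z * circleMap 0 1 θ)‖ ^ 2 := by
      rw [h8_rot, hzR]
    have i1 : IntervalIntegrable (fun θ : ℝ => ‖F (r * circleMap 0 1 θ)‖ ^ 2)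
      MeasureTheory.volume 0 (2 * Real.pi) := (hcr.norm.pow 2).intervalIntegrable _ _
    have i2 : IntervalIntegrable (fun θ : ℝ => ‖F (z * circleMap 0 1 θ)‖ ^ 2)
      MeasureTheory.volume 0 (2 * Real.pi) := (hcz.norm.pow 2).intervalIntegrable _ _
    rw [e1, hI, ← intervalIntegral.integral_add i1 i2, ← intervalIntegral.integral_div]
    refine intervalIntegral.norm_integral_le_of_norm_le hpi ?_ ((i1.add i2).div_const 2)
    refine Filter.Eventually.of_forall fun t _ => ?_
    simp only [hu, norm_mul, RCLike.norm_conj]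
    nlinarith [sq_nonneg (‖F (r * circleMap 0 1 t)‖ - ‖F (z * circleMap 0 1 t)‖)]
  · exact subset_closure (by simpa [abs_of_nonneg hr] using hlt)

theorem h8_inner {G : ℂ → ℂ} (hG : DifferentiableOn ℂ G (ball (0:ℂ) 1)) {l : ℂ} (hl : ‖l‖ < 1)
    {r : ℝ} (hr : 0 < r) (hr1 : r < 1) :
    circleAverage (fun z => G z * (starRingEnd ℂ) (1 - (starRingEnd ℂ) l * z)⁻¹) 0 r
      = G (r ^ 2 * l) := by
  have hD : DiffContOnCl ℂ G (ball 0 |r|) := by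
    refine DifferentiableOn.diffContOnCl (hG.mono ?_)
    rw [abs_of_pos hr, closure_ball _ hr.ne']
    exact closedBall_subset_ball hr1
  rw [← hD.circleAverage_smul_div (w := r ^ 2 * l)]
  · apply Real.circleAverage_congr_sphere
    intro z hz
    rw [abs_of_pos hr] at hz
    have hz' : ‖z‖ = r := by simpa using hz
    have hz0 : z ≠ 0 := by rintro rfl; simp at hz'; linarith
    have hzz : z * (starRingEnd ℂ) z = r ^ 2 := by rw [Complex.mul_conj', hz']
    have hne : z - r ^ 2 * l ≠ 0 := by
      intro h
      have : ‖z‖ = r ^ 2 * ‖l‖ := by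
        rw [sub_eq_zero.1 h]; simp
      rw [hz'] at this
      nlinarith [norm_nonneg l]
    have hfac : z - r ^ 2 * l = z * (1 - l * (starRingEnd ℂ) z) := by
      rw [← hzz]; ring
    have hne2 : 1 - l * (starRingEnd ℂ) z ≠ 0 := by
      intro h; apply hne; rw [hfac, h, mul_zero]
    simp only [map_inv₀, map_sub, map_one, map_mul, Complex.conj_conj, sub_zero, smul_eq_mul, hfac]
    field_simp
  · rw [abs_of_pos hr]
    simp only [mem_ball_zero_iff, norm_mul, norm_pow, Complex.norm_real, Real.norm_eq_abs, sq_abs]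
    nlinarith [norm_nonneg l]

theorem h8_ne {l z : ℂ} (hl : ‖l‖ < 1) (hz : ‖z‖ ≤ 1) : 1 - (starRingEnd ℂ) l * z ≠ 0 := by
  intro h
  have : ‖(starRingEnd ℂ) l * z‖ = 1 := by rw [← sub_eq_zero.1 h]; simp
  rw [norm_mul, RCLike.norm_conj] at this
  nlinarith [norm_nonneg l, norm_nonneg z]

theorem h8_kdiff {l : ℂ} (hl : ‖l‖ < 1) :
    DifferentiableOn ℂ (fun z => (1 - (starRingEnd ℂ) l * z)⁻¹) (ball (0:ℂ) 1) := by
  refine DifferentiableOn.inv (by fun_prop) fun z hz => h8_ne hl ?_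
  have : ‖z‖ < 1 := by simpa using hz
  exact this.le

theorem h8_mean {f : ℂ → ℂ} (hf : DifferentiableOn ℂ f (ball (0:ℂ) 1)) {l : ℂ} (hl : ‖l‖ < 1)
    (a : ℂ) {r : ℝ} (hr : 0 < r) (hr1 : r < 1) :
    circleAverage (fun z => ‖f z - a * (1 - (starRingEnd ℂ) l * z)⁻¹‖ ^ 2) 0 r
      = circleAverage (fun z => ‖f z‖ ^ 2) 0 r
        - ((starRingEnd ℂ) a * (2 * f (r ^ 2 * l)
          - a * (1 - (starRingEnd ℂ) l * (r ^ 2 * l))⁻¹)).re := by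
  have hk := h8_kdiff hl
  have hG : DifferentiableOn ℂ (fun z => (starRingEnd ℂ) a *
      (2 * f z - a * (1 - (starRingEnd ℂ) l * z)⁻¹)) (ball (0:ℂ) 1) := by
    fun_prop
  have hsub : sphere (0:ℂ) r ⊆ ball 0 1 := sphere_subset_closedBall.trans (closedBall_subset_ball hr1)
  have hin := h8_inner hG hl hr hr1
  have hci : CircleIntegrable (fun z => (starRingEnd ℂ) a *
      (2 * f z - a * (1 - (starRingEnd ℂ) l * z)⁻¹) *
      (starRingEnd ℂ) (1 - (starRingEnd ℂ) l * z)⁻¹) 0 r := by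
    apply ContinuousOn.circleIntegrable hr.le
    refine (hG.continuousOn.mono hsub).mul ?_
    exact Complex.continuous_conj.comp_continuousOn (hk.continuousOn.mono hsub)
  have hre := Complex.reCLM.circleAverage_comp_comm hci
  rw [hin] at hre
  simp only [Complex.reCLM_apply] at hre
  rw [← hre, ← Real.circleAverage_fun_sub]
  · congr 1
    ext z
    simp only [Function.comp, Complex.reCLM_apply, ← Complex.normSq_eq_norm_sq]
    generalize (1 - (starRingEnd ℂ) l * z)⁻¹ = k
    simp [Complex.normSq_apply]
    ring
  · exact ContinuousOn.circleIntegrable hr.le ((hf.continuousOn.mono hsub).norm.pow 2)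
  · apply ContinuousOn.circleIntegrable hr.le
    refine Complex.continuous_re.comp_continuousOn ?_
    refine (hG.continuousOn.mono hsub).mul ?_
    exact Complex.continuous_conj.comp_continuousOn (hk.continuousOn.mono hsub)

theorem h8_step {f : ℂ → ℂ} (hf : DifferentiableOn ℂ f (ball (0:ℂ) 1)) {A : ℝ}
    (hA : ∀ r : ℝ, 0 ≤ r → r < 1 → circleAverage (fun z => ‖f z‖ ^ 2) 0 r ≤ A)
    {l : ℂ} (hl : ‖l‖ < 1) :
    ∃ f1 : ℂ → ℂ, DifferentiableOn ℂ f1 (ball (0:ℂ) 1) ∧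
      (∀ r : ℝ, 0 ≤ r → r < 1 → circleAverage (fun z => ‖f1 z‖ ^ 2) 0 r
        ≤ A - ‖f l‖ ^ 2 * (1 - ‖l‖ ^ 2)) ∧
      ∀ z ∈ ball (0:ℂ) 1, f z = f l * (1 - ‖l‖ ^ 2 : ℝ) * (1 - (starRingEnd ℂ) l * z)⁻¹
        + blaschke8 l z * f1 z := by
  set a : ℂ := f l * (1 - ‖l‖ ^ 2 : ℝ) with ha
  have hk := h8_kdiff hl
  have hlb : l ∈ ball (0:ℂ) 1 := by simpa using hl
  have hll : 1 - (starRingEnd ℂ) l * l = ((1 - ‖l‖ ^ 2 : ℝ) : ℂ) := by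
    rw [Complex.conj_mul']; push_cast; rfl
  have hll0 : 1 - (starRingEnd ℂ) l * l ≠ 0 := h8_ne hl hl.le
  set F : ℂ → ℂ := fun z => f z - a * (1 - (starRingEnd ℂ) l * z)⁻¹ with hFdef
  have hF : DifferentiableOn ℂ F (ball (0:ℂ) 1) := by
    rw [hFdef]; fun_prop
  have hFl : F l = 0 := by
    rw [hll] at hll0
    simp only [hFdef, ha, hll]
    field_simp
    ring
  set D := dslope F l with hDdef
  have hD : DifferentiableOn ℂ D (ball (0:ℂ) 1) :=
    (Complex.differentiableOn_dslope (isOpen_ball.mem_nhds hlb)).2 hF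
  have hFD : ∀ z, F z = (z - l) * D z := by
    intro z
    have := sub_smul_dslope F l z
    rw [hFl, sub_zero, smul_eq_mul] at this
    exact this.symm
  set f1 : ℂ → ℂ := fun z => -(1 - (starRingEnd ℂ) l * z) * D z with hf1
  have hf1d : DifferentiableOn ℂ f1 (ball (0:ℂ) 1) := by
    rw [hf1]; fun_prop
  refine ⟨f1, hf1d, ?_, ?_⟩
  · intro r0 hr0 hr01
    set K : ℝ → ℝ := fun r => 1 + (1 - ‖l‖ ^ 2) * (1 - r ^ 2) / (r - ‖l‖) ^ 2 with hK
    set E : ℝ → ℝ := fun r => A - ((starRingEnd ℂ) a * (2 * f (r ^ 2 * l)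
          - a * (1 - (starRingEnd ℂ) l * (r ^ 2 * l))⁻¹)).re with hE
    have hl1 : 1 - ‖l‖ ≠ 0 := by linarith
    have hKt : ContinuousAt K 1 := by
      rw [hK]
      refine ContinuousAt.add (by fun_prop) (ContinuousAt.div (by fun_prop) (by fun_prop) ?_)
      positivity
    have hin : ContinuousAt (fun r : ℝ => ((r:ℂ) ^ 2 * l)) 1 := by fun_prop
    have hfl : ContinuousAt f l := (hf.differentiableAt (isOpen_ball.mem_nhds hlb)).continuousAt
    have hEt : ContinuousAt E 1 := by
      rw [hE]
      have h1 : ContinuousAt (fun r : ℝ => f ((r:ℂ) ^ 2 * l)) 1 :=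
        ContinuousAt.comp (g := f) (f := fun r : ℝ => (r:ℂ) ^ 2 * l) (by simpa using hfl) hin
      have h2 : ContinuousAt (fun r : ℝ => (1 - (starRingEnd ℂ) l * ((r:ℂ) ^ 2 * l))⁻¹) 1 := by
        refine ContinuousAt.inv₀ (by fun_prop) (by simpa using hll0)
      refine continuousAt_const.sub ?_
      refine Complex.continuous_re.continuousAt.comp ?_
      exact continuousAt_const.mul ((continuousAt_const.mul h1).sub (continuousAt_const.mul h2))
    have hlim : Filter.Tendsto (fun r => K r * E r) (nhdsWithin 1 (Set.Iio 1))
        (nhds (K 1 * E 1)) := (hKt.mul hEt).tendsto.mono_left nhdsWithin_le_nhds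
    have hval : K 1 * E 1 = A - ‖f l‖ ^ 2 * (1 - ‖l‖ ^ 2) := by
      have e1 : (2 * f (((1:ℝ):ℂ) ^ 2 * l)
          - a * (1 - (starRingEnd ℂ) l * (((1:ℝ):ℂ) ^ 2 * l))⁻¹) = f l := by
        simp only [Complex.ofReal_one, one_pow, one_mul]
        have : a * (1 - (starRingEnd ℂ) l * l)⁻¹ = f l := by
          have := hFl
          simp only [hFdef] at this
          exact (sub_eq_zero.1 this).symm
        rw [this]; ring
      have e2 : ((starRingEnd ℂ) a * f l).re = ‖f l‖ ^ 2 * (1 - ‖l‖ ^ 2) := by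
        rw [ha, map_mul, Complex.conj_ofReal, mul_right_comm, Complex.conj_mul']
        norm_cast
      simp only [hK, hE, e1, e2]
      simp
    rw [← hval]
    refine ge_of_tendsto hlim ?_
    have hev : Set.Ioo (max r0 ‖l‖) 1 ∈ nhdsWithin (1:ℝ) (Set.Iio 1) :=
      Ioo_mem_nhdsLT (max_lt hr01 hl)
    filter_upwards [hev] with r hr
    have hr1 : r < 1 := hr.2
    have hr0r : r0 < r := (le_max_left _ _).trans_lt hr.1
    have hlr : ‖l‖ < r := (le_max_right _ _).trans_lt hr.1
    have hrpos : 0 < r := (norm_nonneg l).trans_lt hlr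
    refine (h8_mono hf1d hr0 hr0r.le hr1).trans ?_
    have hsub : sphere (0:ℂ) r ⊆ ball 0 1 :=
      sphere_subset_closedBall.trans (closedBall_subset_ball hr1)
    have hK0 : 0 ≤ K r := by
      have h1 : 0 ≤ 1 - ‖l‖ ^ 2 := by nlinarith [norm_nonneg l]
      have h2 : 0 ≤ 1 - r ^ 2 := by nlinarith
      simp only [hK]
      positivity
    have hFm : circleAverage (fun z => ‖F z‖ ^ 2) 0 r ≤ E r := by
      rw [hFdef, h8_mean hf hl a hrpos hr1]
      have := hA r hrpos.le hr1
      simp only [hE]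
      linarith
    refine le_trans ?_ (mul_le_mul_of_nonneg_left hFm hK0)
    rw [← smul_eq_mul, ← Real.circleAverage_fun_smul]
    have cF := ((hF.continuousOn.mono hsub).norm.pow 2)
    apply Real.circleAverage_mono
    · exact ContinuousOn.circleIntegrable hrpos.le ((hf1d.continuousOn.mono hsub).norm.pow 2)
    · exact ContinuousOn.circleIntegrable hrpos.le (cF.const_smul (K r))
    · intro z hz
      rw [abs_of_pos hrpos] at hz
      have hz' : ‖z‖ = r := by simpa using hz
      have hid : ‖1 - (starRingEnd ℂ) l * z‖ ^ 2
          = ‖z - l‖ ^ 2 + (1 - ‖l‖ ^ 2) * (1 - r ^ 2) := by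
        rw [← hz']
        simp only [← Complex.normSq_eq_norm_sq]
        simp [Complex.normSq_apply]
        ring
      have hge : r - ‖l‖ ≤ ‖z - l‖ := by
        rw [← hz']; exact norm_sub_norm_le z l
      have hpos : 0 < r - ‖l‖ := by linarith
      have hQ : 0 ≤ (1 - ‖l‖ ^ 2) * (1 - r ^ 2) := by
        have h1 : 0 ≤ 1 - ‖l‖ ^ 2 := by nlinarith [norm_nonneg l]
        have h2 : 0 ≤ 1 - r ^ 2 := by nlinarith
        positivity
      have hKz : ‖1 - (starRingEnd ℂ) l * z‖ ^ 2 ≤ K r * ‖z - l‖ ^ 2 := by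
        rw [hid]
        simp only [hK]
        rw [add_mul, one_mul, div_mul_eq_mul_div]
        gcongr
        rw [le_div_iff₀ (by positivity)]
        gcongr
      simp only [hf1, hFD z, norm_mul, norm_neg, mul_pow, smul_eq_mul]
      rw [← mul_assoc]
      gcongr
  · intro z hz
    have hz1 : ‖z‖ < 1 := by simpa using hz
    have hne := h8_ne hl hz1.le
    have h1 : blaschke8 l z * f1 z = F z := by
      rw [hFD z]
      simp only [blaschke8, hf1]
      rw [neg_mul, mul_neg, ← mul_assoc, div_mul_cancel₀ _ hne]
      ring
    rw [h1]
    simp only [hFdef]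
    ring

theorem h8_real {x y q p A S : ℝ} (hq : 0 ≤ q) (hp : 0 ≤ p)
    (hS : 0 ≤ S) (hqA : q ≤ A) (hxe : x ^ 2 = q * p) (hye : y ^ 2 ≤ (A - q) * S) :
    (x + y) ^ 2 ≤ A * (p + S) := by
  have h0 : 0 ≤ A - q := by linarith
  have h1 : (2 * (x * y)) ^ 2 ≤ (q * S + (A - q) * p) ^ 2 := by
    have : x ^ 2 * y ^ 2 ≤ (q * p) * ((A - q) * S) := by
      rw [hxe]; gcongr
    nlinarith [sq_nonneg (q * S - (A - q) * p)]
  have h2 := abs_le_of_sq_le_sq h1 (by positivity)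
  nlinarith [(abs_le.1 h2).2]

theorem h8_bnorm {l ζ : ℂ} (hz : ‖ζ‖ = 1) :
    ‖1 - (starRingEnd ℂ) l * ζ‖ = ‖ζ - l‖ := by
  have h1 : ζ * (starRingEnd ℂ) ζ = 1 := by rw [Complex.mul_conj', hz]; simp
  have h2 : 1 - (starRingEnd ℂ) l * ζ = ζ * (starRingEnd ℂ) (ζ - l) := by
    rw [map_sub, mul_sub, h1]; ring
  rw [h2, norm_mul, hz, one_mul, RCLike.norm_conj]

theorem h8_main (n : ℕ) : ∀ (l : Fin n → ℂ), (∀ j, ‖l j‖ < 1) → ∀ (f : ℂ → ℂ) (A : ℝ), 0 ≤ A →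
    DifferentiableOn ℂ f (ball (0:ℂ) 1) →
    (∀ r : ℝ, 0 ≤ r → r < 1 → circleAverage (fun z => ‖f z‖ ^ 2) 0 r ≤ A) →
    ∃ g h : ℂ → ℂ, DiffContOnCl ℂ g (ball (0:ℂ) 1) ∧ DifferentiableOn ℂ h (ball (0:ℂ) 1) ∧
      (∀ r : ℝ, 0 ≤ r → r < 1 → circleAverage (fun z => ‖h z‖ ^ 2) 0 r ≤ A) ∧
      (∀ z ∈ ball (0:ℂ) 1, g z - f z = finBlaschke8 n l z * h z) ∧
      ∀ ζ : ℂ, ‖ζ‖ = 1 → ‖g ζ‖ ^ 2 ≤ A * ∑ k, (1 - ‖l k‖ ^ 2) / ‖ζ - l k‖ ^ 2 := by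
  induction n with
  | zero =>
    intro l hl f A hA hf hfA
    refine ⟨fun _ => 0, fun z => - f z, diffContOnCl_const, hf.neg, ?_, ?_, ?_⟩
    · simpa using hfA
    · simp [finBlaschke8]
    · simp
  | succ n ih =>
    intro l hl f A hA hf hfA
    have hl0 := hl 0
    obtain ⟨f1, hf1, hf1A, hfe⟩ := h8_step hf hfA hl0
    have hp0 : 0 < 1 - ‖l 0‖ ^ 2 := by nlinarith [norm_nonneg (l 0)]
    have hA1 : 0 ≤ A - ‖f (l 0)‖ ^ 2 * (1 - ‖l 0‖ ^ 2) := by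
      refine le_trans ?_ (hf1A 0 le_rfl one_pos)
      apply Real.circleAverage_nonneg_of_nonneg
      intro x _
      positivity
    obtain ⟨g1, h, hg1, hh, hhA, hgh, hgb⟩ :=
      ih (fun j => l j.succ) (fun j => hl _) f1 _ hA1 hf1 hf1A
    have hkc : DiffContOnCl ℂ (fun z => (1 - (starRingEnd ℂ) (l 0) * z)⁻¹) (ball (0:ℂ) 1) := by
      refine DifferentiableOn.diffContOnCl ?_
      rw [closure_ball _ one_ne_zero]
      exact DifferentiableOn.inv (by fun_prop) fun z hz => h8_ne hl0 (by simpa using hz)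
    have hbc : DiffContOnCl ℂ (fun z => (l 0 - z) * (1 - (starRingEnd ℂ) (l 0) * z)⁻¹)
        (ball (0:ℂ) 1) := by
      refine DiffContOnCl.smul (𝕜' := ℂ) (c := fun z => l 0 - z) ?_ hkc
      exact Differentiable.diffContOnCl (by fun_prop)
    refine ⟨fun z => f (l 0) * (1 - ‖l 0‖ ^ 2 : ℝ) * (1 - (starRingEnd ℂ) (l 0) * z)⁻¹
        + ((l 0 - z) * (1 - (starRingEnd ℂ) (l 0) * z)⁻¹) * g1 z, h, ?_, hh, ?_, ?_, ?_⟩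
    · exact (hkc.const_smul (f (l 0) * (1 - ‖l 0‖ ^ 2 : ℝ))).add (hbc.smul hg1)
    · intro r h0 h1
      refine (hhA r h0 h1).trans ?_
      have : 0 ≤ ‖f (l 0)‖ ^ 2 * (1 - ‖l 0‖ ^ 2) := by positivity
      linarith
    · intro z hz
      have e := hgh z hz
      have e3 : finBlaschke8 (n + 1) l z
          = blaschke8 (l 0) z * finBlaschke8 n (fun j => l j.succ) z := by
        simp [finBlaschke8, Fin.prod_univ_succ]
      rw [e3, mul_assoc (blaschke8 (l 0) z), ← e, hfe z hz]
      simp only [blaschke8, div_eq_mul_inv]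
      ring
    · intro ζ hζ
      rw [Fin.sum_univ_succ]
      have hd0 : 0 < ‖ζ - l 0‖ := by
        rw [← h8_bnorm hζ]
        exact norm_pos_iff.2 (h8_ne hl0 hζ.le)
      have hx : ‖f (l 0) * (1 - ‖l 0‖ ^ 2 : ℝ) * (1 - (starRingEnd ℂ) (l 0) * ζ)⁻¹‖
          = ‖f (l 0)‖ * (1 - ‖l 0‖ ^ 2) / ‖ζ - l 0‖ := by
        rw [norm_mul, norm_mul, norm_inv, h8_bnorm hζ, Complex.norm_real, Real.norm_eq_abs,
          abs_of_pos hp0, div_eq_mul_inv]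
      have hy : ‖((l 0 - ζ) * (1 - (starRingEnd ℂ) (l 0) * ζ)⁻¹) * g1 ζ‖ = ‖g1 ζ‖ := by
        rw [norm_mul, norm_mul, norm_inv, h8_bnorm hζ, norm_sub_rev, mul_inv_cancel₀ hd0.ne',
          one_mul]
      refine (pow_le_pow_left₀ (norm_nonneg _) (norm_add_le _ _) 2).trans ?_
      rw [hx, hy]
      refine h8_real (q := ‖f (l 0)‖ ^ 2 * (1 - ‖l 0‖ ^ 2)) (by positivity) (by positivity) ?_
        (by linarith) ?_ (hgb ζ hζ)
      · refine Finset.sum_nonneg fun i _ => ?_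
        have : 0 ≤ 1 - ‖l i.succ‖ ^ 2 := by nlinarith [norm_nonneg (l i.succ), hl i.succ]
        positivity
      · field_simp

theorem h8_conv (f : ℂ → ℂ) (r : ℝ) : (1 / (2 * Real.pi)) *
          ∫ θ in (0:ℝ)..(2 * Real.pi),
            ‖f ((r : ℂ) * Complex.exp (θ * Complex.I))‖ ^ 2
      = circleAverage (fun z => ‖f z‖ ^ 2) 0 r := by
  simp [circleAverage, circleMap]

/-- for `f ∈ H²` with `‖f‖ ≤ 1` there is `g ∈ H^∞` with
`g - f ∈ B_σ H²` and `‖g‖_∞ ≤ sup_{ζ∈𝕋} (∑_k (1-|λ_k|²)/|ζ-λ_k|²)^{1/2}`. -/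
theorem stmt_8 (n : ℕ) (l : Fin n → ℂ) (hl : ∀ j, ‖l j‖ < 1)
    (f : ℂ → ℂ) (hf : MemH2le8 f 1) :
    ∃ g : ℂ → ℂ, DifferentiableOn ℂ g (ball (0:ℂ) 1) ∧
      (∃ h : ℂ → ℂ, (∃ M : ℝ, MemH2le8 h M) ∧
        ∀ z ∈ ball (0:ℂ) 1, g z - f z = finBlaschke8 n l z * h z) ∧
      ∀ z ∈ ball (0:ℂ) 1,
        ‖g z‖ ≤ ⨆ ζ : Metric.sphere (0:ℂ) 1,
          Real.sqrt (∑ k, (1 - ‖l k‖ ^ 2) / ‖(ζ : ℂ) - l k‖ ^ 2) := by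
  obtain ⟨hfd, hfm⟩ := hf
  obtain ⟨g, h, hg, hh, hhA, hgh, hgb⟩ := h8_main n l hl f 1 zero_le_one hfd (fun r h0 h1 => by
    rw [← h8_conv]; simpa using hfm r h0 h1)
  refine ⟨g, hg.differentiableOn, ⟨h, ⟨1, hh, fun r h0 h1 => ?_⟩, hgh⟩, ?_⟩
  · rw [h8_conv]; simpa using hhA r h0 h1
  · intro z hz
    refine Complex.norm_le_of_forall_mem_frontier_norm_le isBounded_ball hg ?_ (subset_closure hz)
    intro ζ hζ
    rw [frontier_ball _ one_ne_zero] at hζ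
    have hζ1 : ‖ζ‖ = 1 := by simpa using hζ
    have hbd : BddAbove (Set.range fun ζ : Metric.sphere (0:ℂ) 1 =>
        Real.sqrt (∑ k, (1 - ‖l k‖ ^ 2) / ‖(ζ : ℂ) - l k‖ ^ 2)) := by
      refine (isCompact_range ?_).bddAbove
      refine Continuous.sqrt (continuous_finsetSum _ fun k _ => ?_)
      refine Continuous.div (by fun_prop) (by fun_prop) fun x => ?_
      have hx : ‖(x:ℂ)‖ = 1 := by simpa using x.2
      rw [← h8_bnorm hx]
      exact pow_ne_zero _ (norm_ne_zero_iff.2 (h8_ne (hl k) hx.le))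
    refine le_trans ?_ (le_ciSup hbd ⟨ζ, hζ⟩)
    exact Real.le_sqrt_of_sq_le (by simpa using hgb ζ hζ1)
end

section
/- Let σ = {λ₁,…,λₙ} ⊂ 𝔻 with |λ_j| ≤ r < 1 for all j. Then the interpolation constant c(σ, H², H^∞) = sup{inf{‖g‖_∞ : g ∈ H^∞, g - f ∈ B_σ H²} : f ∈ H², ‖f‖_{H²} ≤ 1} satisfies c(σ, H², H^∞) ≤ √2 · √(n/(1-r)). -/
open Complex Metric

noncomputable def blaschke9 (l z : ℂ) : ℂ := (l - z) / (1 - (starRingEnd ℂ) l * z)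

noncomputable def finBlaschke9 (n : ℕ) (l : Fin n → ℂ) (z : ℂ) : ℂ :=
  ∏ j, blaschke9 (l j) z

/-- `f ∈ H²` with `H²` norm at most `M`. -/
def MemH2le9 (f : ℂ → ℂ) (M : ℝ) : Prop :=
  DifferentiableOn ℂ f (ball (0:ℂ) 1) ∧
    ∀ ρ : ℝ, 0 ≤ ρ → ρ < 1 →
      (1 / (2 * Real.pi)) *
          ∫ θ in (0:ℝ)..(2 * Real.pi),
            ‖f ((ρ : ℂ) * Complex.exp (θ * Complex.I))‖ ^ 2 ≤ M ^ 2

theorem kernel_pos9 {l z : ℂ} (_ : ‖l‖ < 1) (hz : ‖z‖ < 1) :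
    1 - ‖l‖ ≤ ‖1 - (starRingEnd ℂ) l * z‖ := by
  have h1 := norm_sub_norm_le (1:ℂ) ((starRingEnd ℂ) l * z)
  have h2 : ‖(starRingEnd ℂ) l * z‖ ≤ ‖l‖ := by
    rw [norm_mul, RCLike.norm_conj]
    nlinarith [norm_nonneg l]
  rw [norm_one] at h1
  linarith

theorem kernel_ne9 {l z : ℂ} (hl : ‖l‖ < 1) (hz : ‖z‖ < 1) :
    1 - (starRingEnd ℂ) l * z ≠ 0 := by
  have := kernel_pos9 hl hz
  intro h
  rw [h, norm_zero] at this
  linarith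

theorem blaschke_id9 (l z : ℂ) :
    ‖1 - (starRingEnd ℂ) l * z‖ ^ 2 = ‖z - l‖ ^ 2 + (1 - ‖z‖ ^ 2) * (1 - ‖l‖ ^ 2) := by
  simp only [Complex.sq_norm, Complex.normSq_apply]
  simp
  ring

theorem blaschke_le9 {l z : ℂ} (hl : ‖l‖ < 1) (hz : ‖z‖ < 1) : ‖blaschke9 l z‖ ≤ 1 := by
  have h := blaschke_id9 l z
  have hp := kernel_pos9 hl hz
  rw [blaschke9, norm_div, div_le_one (by linarith), norm_sub_rev]
  apply abs_le_of_sq_le_sq' _ (norm_nonneg _) |>.2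
  have : 0 ≤ (1 - ‖z‖ ^ 2) * (1 - ‖l‖ ^ 2) := by
    apply mul_nonneg <;> nlinarith [norm_nonneg l, norm_nonneg z]
  linarith

theorem blaschke_diff9 {l : ℂ} (hl : ‖l‖ < 1) :
    DifferentiableOn ℂ (blaschke9 l) (ball 0 1) := by
  intro z hz
  have := kernel_ne9 hl (mem_ball_zero_iff.1 hz)
  unfold blaschke9
  apply DifferentiableAt.differentiableWithinAt
  fun_prop (disch := assumption)

/-- the quadratic circle mean -/
noncomputable def mean9 (f : ℂ → ℂ) (ρ : ℝ) : ℝ :=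
  Real.circleAverage (fun z => ‖f z‖ ^ 2) 0 ρ

theorem mean_eq9 (f : ℂ → ℂ) (ρ : ℝ) : (1 / (2 * Real.pi)) *
          ∫ θ in (0:ℝ)..(2 * Real.pi),
            ‖f ((ρ : ℂ) * Complex.exp (θ * Complex.I))‖ ^ 2 = mean9 f ρ := by
  simp [mean9, Real.circleAverage_def, circleMap]

theorem mean_nonneg9 (f : ℂ → ℂ) (ρ : ℝ) : 0 ≤ mean9 f ρ :=
  Real.circleAverage_nonneg_of_nonneg (fun _ _ => by positivity)

theorem mem_of_sphere9 {ρ : ℝ} (h0 : 0 ≤ ρ) (h1 : ρ < 1) {z : ℂ} (hz : z ∈ sphere (0:ℂ) |ρ|) :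
    ‖z‖ = ρ ∧ ‖z‖ < 1 := by
  rw [mem_sphere_zero_iff_norm, abs_of_nonneg h0] at hz
  exact ⟨hz, by linarith⟩

theorem cont_sphere9 {f : ℂ → ℂ} (hf : DifferentiableOn ℂ f (ball 0 1)) {ρ : ℝ} (h0 : 0 ≤ ρ)
    (h1 : ρ < 1) : ContinuousOn f (sphere (0:ℂ) |ρ|) :=
  hf.continuousOn.mono fun _ hz => mem_ball_zero_iff.2 (mem_of_sphere9 h0 h1 hz).2

/-- reproducing formula -/
theorem repro9 {F : ℂ → ℂ} (hF : DifferentiableOn ℂ F (ball 0 1)) {l : ℂ} (hl : ‖l‖ < 1)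
    (k0 : ℂ) {ρ : ℝ} (h0 : 0 < ρ) (h1 : ρ < 1) :
    Real.circleAverage (fun z => (starRingEnd ℂ) (k0 / (1 - (starRingEnd ℂ) l * z)) * F z) 0 ρ
      = (starRingEnd ℂ) k0 * F (ρ ^ 2 * l) := by
  have hd : DiffContOnCl ℂ F (ball 0 |ρ|) := by
    apply DifferentiableOn.diffContOnCl
    apply hF.mono
    rw [abs_of_pos h0]
    exact closure_ball_subset_closedBall.trans (closedBall_subset_ball h1)
  have hw : (ρ ^ 2 * l : ℂ) ∈ ball (0:ℂ) |ρ| := by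
    rw [mem_ball_zero_iff, norm_mul, norm_pow, Complex.norm_real, Real.norm_eq_abs, abs_of_pos h0]
    nlinarith [norm_nonneg l, mul_pos h0 h0]
  have := hd.circleAverage_smul_div hw
  rw [← this, ← smul_eq_mul, ← Real.circleAverage_fun_smul]
  apply Real.circleAverage_congr_sphere
  intro z hz
  obtain ⟨hz1, hz2⟩ := mem_of_sphere9 h0.le h1 hz
  have hz0 : z ≠ 0 := by
    rw [← norm_pos_iff]; linarith
  have hzz : z * (starRingEnd ℂ) z = ρ ^ 2 := by
    rw [Complex.mul_conj, Complex.normSq_eq_norm_sq, hz1]; push_cast; rfl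
  have hne : 1 - l * (starRingEnd ℂ) z ≠ 0 := by
    have := kernel_ne9 hl hz2
    intro h
    apply this
    have h2 := congrArg (starRingEnd ℂ) h
    simpa using h2
  have hE : z - ρ ^ 2 * l = z * (1 - l * (starRingEnd ℂ) z) := by
    rw [← hzz]; ring
  simp only [smul_eq_mul, map_div₀, map_sub, map_mul, map_one, Complex.conj_conj, sub_zero]
  rw [hE]
  field_simp

theorem mean_sub9 {f : ℂ → ℂ} (hf : DifferentiableOn ℂ f (ball 0 1)) {l : ℂ} (hl : ‖l‖ < 1)
    (k0 : ℂ) {ρ : ℝ} (h0 : 0 < ρ) (h1 : ρ < 1) :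
    mean9 (fun z => f z - k0 / (1 - (starRingEnd ℂ) l * z)) ρ = mean9 f ρ -
      ((starRingEnd ℂ) k0 * (2 * f (ρ ^ 2 * l) -
        k0 / (1 - (starRingEnd ℂ) l * (ρ ^ 2 * l)))).re := by
  have hk : DifferentiableOn ℂ (fun z => k0 / (1 - (starRingEnd ℂ) l * z)) (ball 0 1) := by
    intro z hz
    have := kernel_ne9 hl (mem_ball_zero_iff.1 hz)
    apply DifferentiableAt.differentiableWithinAt
    fun_prop (disch := assumption)
  set k : ℂ → ℂ := fun z => k0 / (1 - (starRingEnd ℂ) l * z) with hkdef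
  have hF : DifferentiableOn ℂ (fun z => 2 * f z - k z) (ball 0 1) :=
    (hf.const_mul 2).sub hk
  have hr := repro9 hF hl k0 h0 h1
  have cf := cont_sphere9 hf h0.le h1
  have ck := cont_sphere9 hk h0.le h1
  have cF := cont_sphere9 hF h0.le h1
  have cG : ContinuousOn (fun z => (starRingEnd ℂ) (k z) * (2 * f z - k z)) (sphere (0:ℂ) |ρ|) :=
    (Complex.continuous_conj.comp_continuousOn ck).mul cF
  have hre := Complex.reCLM.circleAverage_comp_comm cG.circleIntegrable'
  have h3 : (Real.circleAverage (fun z => (starRingEnd ℂ) (k z) * (2 * f z - k z)) 0 ρ)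
     = (starRingEnd ℂ) k0 * (2 * f (ρ ^ 2 * l) - k (ρ ^ 2 * l)) := hr
  rw [h3] at hre
  change _ = _ - Complex.reCLM ((starRingEnd ℂ) k0 * (2 * f (ρ ^ 2 * l) - k (ρ ^ 2 * l)))
  rw [← hre, mean9, mean9, ← Real.circleAverage_fun_sub]
  · congr 1
    funext z
    simp only [Complex.sq_norm, Complex.normSq_apply, Function.comp, Complex.reCLM_apply]
    simp
    ring
  · exact (cf.norm.pow 2).circleIntegrable'
  · exact (Complex.continuous_re.comp_continuousOn cG).circleIntegrable'

open Filter Topology in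
/-- asymptotic quadratic mean bound -/
def Asym9 (f : ℂ → ℂ) (A : ℝ) : Prop :=
  ∀ ε > 0, ∀ᶠ ρ : ℝ in 𝓝[<] 1, mean9 f ρ ≤ A + ε

open Filter Topology in
theorem asym_nonneg9 {f : ℂ → ℂ} {A : ℝ} (h : Asym9 f A) : 0 ≤ A := by
  apply le_of_forall_pos_le_add
  intro ε hε
  obtain ⟨ρ, hρ⟩ := (h ε hε).exists
  exact (mean_nonneg9 f ρ).trans hρ

open Filter Topology in
theorem step9 {f : ℂ → ℂ} (hf : DifferentiableOn ℂ f (ball 0 1)) {l : ℂ} (hl : ‖l‖ < 1)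
    {A : ℝ} (hA : Asym9 f A) :
    ∃ h : ℂ → ℂ, DifferentiableOn ℂ h (ball 0 1) ∧
      Asym9 h (A - ‖f l‖ ^ 2 * (1 - ‖l‖ ^ 2)) ∧
      ∀ z ∈ ball (0:ℂ) 1,
        f z - (f l * (1 - ‖l‖ ^ 2 : ℝ)) / (1 - (starRingEnd ℂ) l * z) = blaschke9 l z * h z := by
  set k0 : ℂ := f l * (1 - ‖l‖ ^ 2 : ℝ) with hk0
  have hlm : l ∈ ball (0:ℂ) 1 := mem_ball_zero_iff.2 hl
  have hll : 1 - (starRingEnd ℂ) l * l = ((1 - ‖l‖ ^ 2 : ℝ) : ℂ) := by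
    rw [mul_comm, Complex.mul_conj, Complex.normSq_eq_norm_sq]; push_cast; rfl
  have hpos : 0 < 1 - ‖l‖ ^ 2 := by nlinarith [norm_nonneg l]
  have hk : DifferentiableOn ℂ (fun z => k0 / (1 - (starRingEnd ℂ) l * z)) (ball 0 1) := by
    intro z hz
    have := kernel_ne9 hl (mem_ball_zero_iff.1 hz)
    apply DifferentiableAt.differentiableWithinAt
    fun_prop (disch := assumption)
  have hkl : k0 / (1 - (starRingEnd ℂ) l * l) = f l := by
    rw [hll, hk0]
    have : ((1 - ‖l‖ ^ 2 : ℝ) : ℂ) ≠ 0 := by exact_mod_cast hpos.ne'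
    field_simp
  set u : ℂ → ℂ := fun z => f z - k0 / (1 - (starRingEnd ℂ) l * z) with hu
  have hud : DifferentiableOn ℂ u (ball 0 1) := hf.sub hk
  have hul : u l = 0 := by simp only [hu]; rw [hkl, sub_self]
  have hds : DifferentiableOn ℂ (dslope u l) (ball 0 1) :=
    (Complex.differentiableOn_dslope (isOpen_ball.mem_nhds hlm)).2 hud
  have hsl : ∀ z, (z - l) * dslope u l z = u z := by
    intro z
    have := sub_smul_dslope u l z
    rw [hul, sub_zero] at this
    exact this
  set h : ℂ → ℂ := fun z => -(1 - (starRingEnd ℂ) l * z) * dslope u l z with hh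
  have hhd : DifferentiableOn ℂ h (ball 0 1) := by
    apply DifferentiableOn.mul _ hds
    fun_prop
  refine ⟨h, hhd, ?_, ?_⟩
  · intro ε hε
    have hfl : Tendsto (fun ρ : ℝ => f (ρ ^ 2 * l)) (𝓝[<] 1) (𝓝 (f l)) := by
      have hc : ContinuousAt f l := hf.continuousOn.continuousAt (isOpen_ball.mem_nhds hlm)
      have : Tendsto (fun ρ : ℝ => (ρ ^ 2 * l : ℂ)) (𝓝 1) (𝓝 l) := by
        have : Continuous (fun ρ : ℝ => (ρ ^ 2 * l : ℂ)) := by fun_prop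
        simpa using this.tendsto 1
      exact hc.tendsto.comp (this.mono_left nhdsWithin_le_nhds)
    have hkl2 : Tendsto (fun ρ : ℝ => k0 / (1 - (starRingEnd ℂ) l * (ρ ^ 2 * l)))
        (𝓝[<] 1) (𝓝 (f l)) := by
      have hc : ContinuousAt (fun z => k0 / (1 - (starRingEnd ℂ) l * z)) l :=
        hk.continuousOn.continuousAt (isOpen_ball.mem_nhds hlm)
      have : Tendsto (fun ρ : ℝ => (ρ ^ 2 * l : ℂ)) (𝓝 1) (𝓝 l) := by
        have : Continuous (fun ρ : ℝ => (ρ ^ 2 * l : ℂ)) := by fun_prop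
        simpa using this.tendsto 1
      have h2 := hc.tendsto.comp (this.mono_left (nhdsWithin_le_nhds (s := Set.Iio 1)))
      rw [hkl] at h2
      exact h2
    have hE : Tendsto (fun ρ : ℝ => ((starRingEnd ℂ) k0 * (2 * f (ρ ^ 2 * l) -
        k0 / (1 - (starRingEnd ℂ) l * (ρ ^ 2 * l)))).re) (𝓝[<] 1)
        (𝓝 (‖f l‖ ^ 2 * (1 - ‖l‖ ^ 2))) := by
      have h1 := (Complex.continuous_re.tendsto _).comp
        (((hfl.const_mul 2).sub hkl2).const_mul ((starRingEnd ℂ) k0))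
      have h2 : ((starRingEnd ℂ) k0 * (2 * f l - f l)).re = ‖f l‖ ^ 2 * (1 - ‖l‖ ^ 2) := by
        rw [hk0, map_mul, Complex.conj_ofReal]
        have : (starRingEnd ℂ) (f l) * ((1 - ‖l‖ ^ 2 : ℝ) : ℂ) * (2 * f l - f l)
          = ((‖f l‖ ^ 2 * (1 - ‖l‖ ^ 2) : ℝ) : ℂ) := by
          have h3 : f l * (starRingEnd ℂ) (f l) = ((‖f l‖ ^ 2 : ℝ) : ℂ) := by
            rw [Complex.mul_conj, Complex.normSq_eq_norm_sq]
          rw [Complex.ofReal_mul, ← h3]; ring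
        rw [this, Complex.ofReal_re]
      rw [h2] at h1
      exact h1
    set E : ℝ → ℝ := fun ρ : ℝ => ((starRingEnd ℂ) k0 * (2 * f (ρ ^ 2 * l) -
        k0 / (1 - (starRingEnd ℂ) l * (ρ ^ 2 * l)))).re with hEdef
    have hη : Tendsto (fun ρ : ℝ => 1 + (1 - ρ ^ 2) * (1 - ‖l‖ ^ 2) / (ρ - ‖l‖) ^ 2) (𝓝[<] 1)
        (𝓝 1) := by
      have : ContinuousAt (fun ρ : ℝ => 1 + (1 - ρ ^ 2) * (1 - ‖l‖ ^ 2) / (ρ - ‖l‖) ^ 2) 1 := by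
        have : (1 - ‖l‖) ^ 2 ≠ 0 := by
          have : 0 < 1 - ‖l‖ := by linarith
          positivity
        fun_prop (disch := assumption)
      have h2 := this.tendsto
      simp only [one_pow, sub_self, zero_mul, zero_div, add_zero] at h2
      exact h2.mono_left nhdsWithin_le_nhds
    have hlim := hη.mul ((tendsto_const_nhds (x := A + ε / 2)).sub hE)
    have hlt : 1 * (A + ε / 2 - ‖f l‖ ^ 2 * (1 - ‖l‖ ^ 2)) <
        A - ‖f l‖ ^ 2 * (1 - ‖l‖ ^ 2) + ε := by linarith
    have hIoo : ∀ᶠ ρ : ℝ in 𝓝[<] 1, ρ ∈ Set.Ioo ‖l‖ 1 := Ioo_mem_nhdsLT hl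
    filter_upwards [hlim.eventually_lt_const hlt, hA (ε / 2) (by linarith), hIoo]
      with ρ h1 h2 h3
    have hρ0 : 0 < ρ := (norm_nonneg l).trans_lt h3.1
    have hms := mean_sub9 hf hl k0 hρ0 h3.2
    change mean9 u ρ = mean9 f ρ - E ρ at hms
    refine le_trans ?_ h1.le
    have hb : mean9 h ρ ≤ (1 + (1 - ρ ^ 2) * (1 - ‖l‖ ^ 2) / (ρ - ‖l‖) ^ 2) * mean9 u ρ := by
      rw [mean9, mean9, ← smul_eq_mul, ← Real.circleAverage_fun_smul]
      apply Real.circleAverage_mono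
      · exact ((cont_sphere9 hhd hρ0.le h3.2).norm.pow 2).circleIntegrable'
      · exact ((((cont_sphere9 hud hρ0.le h3.2).norm.pow 2).const_smul
          (1 + (1 - ρ ^ 2) * (1 - ‖l‖ ^ 2) / (ρ - ‖l‖) ^ 2))).circleIntegrable'
      intro z hz
      obtain ⟨hz1, hz2⟩ := mem_of_sphere9 hρ0.le h3.2 hz
      simp only [smul_eq_mul]
      rw [← hsl z]
      simp only [hh]
      rw [norm_mul, norm_neg, norm_mul, mul_pow, mul_pow, blaschke_id9, hz1, ← mul_assoc]
      apply mul_le_mul_of_nonneg_right _ (by positivity)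
      have hd : ρ - ‖l‖ ≤ ‖z - l‖ := by
        have := norm_sub_norm_le z l
        rwa [hz1] at this
      have hd0 : 0 < ρ - ‖l‖ := by linarith [h3.1]
      have hN : 0 ≤ (1 - ρ ^ 2) * (1 - ‖l‖ ^ 2) := by
        apply mul_nonneg _ hpos.le
        nlinarith [h3.2]
      rw [add_mul, one_mul]
      apply add_le_add le_rfl
      rw [div_mul_eq_mul_div, le_div_iff₀ (by positivity)]
      apply mul_le_mul_of_nonneg_left _ hN
      gcongr
    refine hb.trans ?_
    have hη0 : 0 ≤ (1 + (1 - ρ ^ 2) * (1 - ‖l‖ ^ 2) / (ρ - ‖l‖) ^ 2) := by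
      have hN : 0 ≤ (1 - ρ ^ 2) * (1 - ‖l‖ ^ 2) := by
        apply mul_nonneg _ hpos.le
        nlinarith [h3.2]
      positivity
    apply mul_le_mul_of_nonneg_left _ hη0
    rw [hms]
    linarith
  · intro z hz
    change u z = _
    have := kernel_ne9 hl (mem_ball_zero_iff.1 hz)
    rw [← hsl z, blaschke9]
    simp only [hh]
    rw [div_mul_eq_mul_div, eq_div_iff this]
    ring

theorem main9 (r : ℝ) (hr0 : 0 ≤ r) (hr : r < 1) (n : ℕ) : ∀ (l : Fin n → ℂ)
    (_ : ∀ j, ‖l j‖ ≤ r) (f : ℂ → ℂ) (A : ℝ) (_ : DifferentiableOn ℂ f (ball 0 1))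
    (_ : Asym9 f A),
    ∃ g h : ℂ → ℂ, DifferentiableOn ℂ g (ball (0:ℂ) 1) ∧ DifferentiableOn ℂ h (ball (0:ℂ) 1) ∧
      (∃ A', Asym9 h A') ∧ (∀ z ∈ ball (0:ℂ) 1, g z - f z = finBlaschke9 n l z * h z) ∧
      ∀ z ∈ ball (0:ℂ) 1, ‖g z‖ ≤ Real.sqrt (A * n) * Real.sqrt (2 / (1 - r)) := by
  induction n with
  | zero =>
    intro l _ f A hf hA
    refine ⟨fun _ => 0, fun z => - f z, differentiableOn_const _, hf.neg, ⟨A, ?_⟩, ?_, ?_⟩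
    · intro ε hε
      have : mean9 (fun z => - f z) = mean9 f := by
        funext ρ
        simp [mean9]
      rw [this]
      exact hA ε hε
    · intro z _
      simp [finBlaschke9]
    · intro z _
      simp
  | succ n ih =>
    intro l hl f A hf hA
    have hl0 : ‖l 0‖ < 1 := (hl 0).trans_lt hr
    obtain ⟨f1, hf1, hA1, he⟩ := step9 hf hl0 hA
    obtain ⟨g1, h1, hg1, hh1, hB, heq, hbd⟩ := ih (fun j => l j.succ) (fun j => hl _) f1 _ hf1 hA1
    have hT := asym_nonneg9 hA1
    have hpos : 0 < 1 - ‖l 0‖ ^ 2 := by nlinarith [norm_nonneg (l 0)]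
    refine ⟨fun z => (f (l 0) * (1 - ‖l 0‖ ^ 2 : ℝ)) / (1 - (starRingEnd ℂ) (l 0) * z)
      + blaschke9 (l 0) z * g1 z, h1, ?_, hh1, hB, ?_, ?_⟩
    · apply DifferentiableOn.add _ ((blaschke_diff9 hl0).mul hg1)
      intro z hz
      have := kernel_ne9 hl0 (mem_ball_zero_iff.1 hz)
      apply DifferentiableAt.differentiableWithinAt
      fun_prop (disch := assumption)
    · intro z hz
      have e1 := he z hz
      have e2 := heq z hz
      have e3 : finBlaschke9 (n + 1) l z =
          blaschke9 (l 0) z * finBlaschke9 n (fun j => l j.succ) z := by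
        simp [finBlaschke9, Fin.prod_univ_succ]
      rw [e3, mul_assoc, ← e2, mul_sub, ← e1]
      ring
    · intro z hz
      have hz1 := mem_ball_zero_iff.1 hz
      set a : ℝ := ‖f (l 0)‖ * Real.sqrt (1 - ‖l 0‖ ^ 2) with ha
      have ha0 : 0 ≤ a := by positivity
      have ha2 : a ^ 2 = ‖f (l 0)‖ ^ 2 * (1 - ‖l 0‖ ^ 2) := by
        rw [ha, mul_pow, Real.sq_sqrt hpos.le]
      rw [← ha2] at hT hbd
      set κ := Real.sqrt (2 / (1 - r)) with hκ
      have hκ0 : 0 ≤ κ := Real.sqrt_nonneg _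
      have hk : ‖(f (l 0) * (1 - ‖l 0‖ ^ 2 : ℝ)) / (1 - (starRingEnd ℂ) (l 0) * z)‖ ≤ a * κ := by
        have hp := kernel_pos9 hl0 hz1
        have h1l : 0 < 1 - ‖l 0‖ := by linarith
        rw [norm_div, norm_mul, Complex.norm_real, Real.norm_eq_abs, abs_of_pos hpos]
        have hs : Real.sqrt (1 - ‖l 0‖ ^ 2) ≤ κ * (1 - ‖l 0‖) := by
          apply Real.sqrt_le_iff.2 ⟨by positivity, ?_⟩
          rw [mul_pow, hκ, Real.sq_sqrt (by apply div_nonneg <;> linarith),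
            div_mul_eq_mul_div, le_div_iff₀ (by linarith)]
          have := hl 0
          have h4 : (1 + ‖l 0‖) * (1 - r) ≤ 2 * (1 - ‖l 0‖) := by
            nlinarith [norm_nonneg (l 0)]
          nlinarith
        rw [div_le_iff₀ (by linarith)]
        have h5 : 1 - ‖l 0‖ ^ 2 = Real.sqrt (1 - ‖l 0‖ ^ 2) * Real.sqrt (1 - ‖l 0‖ ^ 2) :=
          (Real.mul_self_sqrt hpos.le).symm
        calc ‖f (l 0)‖ * (1 - ‖l 0‖ ^ 2) = a * Real.sqrt (1 - ‖l 0‖ ^ 2) := by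
              rw [ha, mul_assoc, ← h5]
          _ ≤ a * (κ * (1 - ‖l 0‖)) := by gcongr
          _ ≤ a * (κ * ‖1 - (starRingEnd ℂ) (l 0) * z‖) := by gcongr
          _ = _ := by ring
      have hg : ‖blaschke9 (l 0) z * g1 z‖ ≤ Real.sqrt ((A - a ^ 2) * n) * κ := by
        rw [norm_mul]
        calc _ ≤ 1 * ‖g1 z‖ := by gcongr; exact blaschke_le9 hl0 hz1
          _ ≤ _ := by rw [one_mul]; exact hbd z hz
      refine (norm_add_le _ _).trans ((add_le_add hk hg).trans ?_)
      rw [← add_mul]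
      apply mul_le_mul_of_nonneg_right _ hκ0
      apply Real.le_sqrt_of_sq_le
      rw [Real.sqrt_mul hT]
      have q1 := Real.sq_sqrt hT
      have q2 := Real.sq_sqrt (Nat.cast_nonneg (α := ℝ) n)
      set s := Real.sqrt (A - a ^ 2)
      set t := Real.sqrt (n : ℝ)
      push_cast
      rw [← q2]
      have : A = s ^ 2 + a ^ 2 := by linarith
      rw [this]
      nlinarith [sq_nonneg (a * t - s)]

open Filter Topology in
theorem asym_mem9 {h : ℂ → ℂ} (hh : DifferentiableOn ℂ h (ball 0 1)) {A : ℝ} (hA : Asym9 h A) :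
    ∃ M : ℝ, MemH2le9 h M := by
  have hA0 := asym_nonneg9 hA
  obtain ⟨ρ0, hρ0, hb⟩ := (mem_nhdsLT_iff_exists_Ioo_subset (a := (1:ℝ))).1 (hA 1 one_pos)
  have hc : ContinuousOn (mean9 h) (Set.Ico 0 1) := by
    apply Real.ContinuousOn.circleAverage _ (fun r hr => hr.1)
    apply ContinuousOn.pow
    apply ContinuousOn.norm
    apply hh.continuousOn.mono
    intro z hz
    simp at hz
    simpa using hz
  have hsub : Set.Icc 0 ρ0 ⊆ Set.Ico (0:ℝ) 1 := fun x hx => ⟨hx.1, hx.2.trans_lt hρ0⟩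
  obtain ⟨C, hC⟩ := isCompact_Icc.exists_bound_of_continuousOn (hc.mono hsub)
  refine ⟨Real.sqrt (max C (A + 1)), hh, fun ρ h0 h1 => ?_⟩
  rw [mean_eq9, Real.sq_sqrt (le_max_of_le_right (by linarith))]
  rcases le_or_gt ρ ρ0 with hle | hgt
  · exact (le_abs_self _).trans ((hC ρ ⟨h0, hle⟩).trans (le_max_left _ _))
  · exact le_trans (hb ⟨hgt, h1⟩) (le_max_right _ _)

/-- the interpolation constant satisfies
`c(σ, H², H^∞) ≤ √2 √(n/(1-r))`: every `f` in the unit ball of `H²` admits an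
interpolant `g ∈ H^∞` (i.e. `g - f ∈ B_σ H²`) with
`‖g‖_∞ ≤ √2 √(n/(1-r))`. -/
theorem stmt_9 (n : ℕ) (l : Fin n → ℂ) (r : ℝ) (hr0 : 0 ≤ r) (hr : r < 1)
    (hl : ∀ j, ‖l j‖ ≤ r) (f : ℂ → ℂ) (hf : MemH2le9 f 1) :
    ∃ g : ℂ → ℂ, DifferentiableOn ℂ g (ball (0:ℂ) 1) ∧
      (∃ h : ℂ → ℂ, (∃ M : ℝ, MemH2le9 h M) ∧
        ∀ z ∈ ball (0:ℂ) 1, g z - f z = finBlaschke9 n l z * h z) ∧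
      ∀ z ∈ ball (0:ℂ) 1,
        ‖g z‖ ≤ Real.sqrt 2 * Real.sqrt (n / (1 - r)) := by
  have hA : Asym9 f 1 := by
    intro ε hε
    have hIoo : Set.Ioo (0:ℝ) 1 ∈ nhdsWithin (1:ℝ) (Set.Iio 1) := Ioo_mem_nhdsLT one_pos
    filter_upwards [hIoo] with ρ hρ
    have := hf.2 ρ hρ.1.le hρ.2
    rw [mean_eq9] at this
    linarith
  obtain ⟨g, h, hg, hh, ⟨A', hA'⟩, he, hb⟩ := main9 r hr0 hr n l hl f 1 hf.1 hA
  refine ⟨g, hg, ⟨h, asym_mem9 hh hA', he⟩, fun z hz => (hb z hz).trans (le_of_eq ?_)⟩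
  rw [← Real.sqrt_mul (by positivity), ← Real.sqrt_mul (by positivity)]
  congr 1
  ring
end

section
/- Let σ = {λ₁,…,λₙ} ⊂ 𝔻 with |λ_j| ≤ r < 1 for all j, let f ∈ H¹ with ‖f‖_{H¹} ≤ 1, and let g = ∑_{k=1}^n ⟨f, e_k⟩ e_k where (e_k) is the Malmquist basis of K_{B_σ} and ⟨h,g⟩ = ∑ ĥ(k)·conj(ĝ(k)). Then ‖g‖_∞ ≤ 2n/(1-r); consequently c(σ, H¹, H^∞) ≤ 2n/(1-r). -/
open Complex Metric

noncomputable def blaschke10 (l z : ℂ) : ℂ := (l - z) / (1 - (starRingEnd ℂ) l * z)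

noncomputable def finBlaschke10 (n : ℕ) (l : Fin n → ℂ) (z : ℂ) : ℂ :=
  ∏ j, blaschke10 (l j) z

/-- The Malmquist basis of `K_{B_σ}`. -/
noncomputable def malmquist10 (n : ℕ) (l : Fin n → ℂ) (k : Fin n) (z : ℂ) : ℂ :=
  (∏ j ∈ Finset.univ.filter (fun j => j < k), blaschke10 (l j) z) *
    ((Real.sqrt (1 - ‖l k‖ ^ 2) : ℂ) / (1 - (starRingEnd ℂ) (l k) * z))

/-- Taylor coefficient `f̂(k)` at the origin. -/
noncomputable def taylorCoeff10 (f : ℂ → ℂ) (k : ℕ) : ℂ :=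
  iteratedDeriv k f 0 / (Nat.factorial k)

/-- The Cauchy sesquilinear pairing `⟨h, g⟩ = ∑ ĥ(k) conj(ĝ(k))`. -/
noncomputable def cauchyPair10 (h g : ℂ → ℂ) : ℂ :=
  ∑' k : ℕ, taylorCoeff10 h k * (starRingEnd ℂ) (taylorCoeff10 g k)


open Filter Topology

lemma hasSum_congr_aux {u v : ℕ → ℂ} {a : ℂ} (h : ∀ j, u j = v j) : HasSum u a ↔ HasSum v a := by
  rw [funext h]

lemma tc_int {F : ℂ → ℂ} {ρ : ℝ} (hρ : 0 < ρ) (hF : DifferentiableOn ℂ F (closedBall (0:ℂ) ρ)) (j : ℕ) :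
    taylorCoeff10 F j * (ρ:ℂ) ^ j = (1 / (2 * Real.pi : ℂ)) *
      ∫ θ in (0:ℝ)..(2 * Real.pi), F ((ρ:ℂ) * exp (θ * I)) * (exp (θ * I))⁻¹ ^ j := by
  have h := DifferentiableOn.circleIntegral_one_div_sub_center_pow_smul hρ j hF
  rw [circleIntegral] at h
  have hρ' : (ρ:ℂ) ≠ 0 := by exact_mod_cast hρ.ne'
  have hpi : (Real.pi:ℂ) ≠ 0 := by exact_mod_cast Real.pi_ne_zero
  have h2 : ∀ θ : ℝ, deriv (circleMap 0 ρ) θ • ((1 / (circleMap 0 ρ θ - 0) ^ (j+1)) • F (circleMap 0 ρ θ))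
      = (I / (ρ:ℂ)^j) * (F ((ρ:ℂ) * exp (θ * I)) * (exp (θ * I))⁻¹ ^ j) := by
    intro θ
    have := exp_ne_zero (θ * I)
    simp only [deriv_circleMap, circleMap_zero, sub_zero, smul_eq_mul, inv_pow, mul_pow]
    field_simp
    ring
  simp_rw [h2] at h
  rw [intervalIntegral.integral_const_mul] at h
  have h3 : (∫ θ in (0:ℝ)..(2 * Real.pi), F ((ρ:ℂ) * exp (θ * I)) * (exp (θ * I))⁻¹ ^ j)
      = (2 * Real.pi : ℂ) * (taylorCoeff10 F j * (ρ:ℂ) ^ j) := by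
    have hI := I_ne_zero
    generalize (∫ θ in (0:ℝ)..(2 * Real.pi), F ((ρ:ℂ) * exp (θ * I)) * (exp (θ * I))⁻¹ ^ j) = X at h ⊢
    have h4 := congrArg (fun x => x * (ρ:ℂ)^j / I) h
    simp only [smul_eq_mul] at h4
    rw [taylorCoeff10]
    convert h4 using 1
    · field_simp
    · field_simp
  rw [h3]; field_simp

lemma tc_hasSum {F : ℂ → ℂ} {R : ℝ} (hF : DifferentiableOn ℂ F (ball (0:ℂ) R)) {z : ℂ} (hz : z ∈ ball (0:ℂ) R) :
    HasSum (fun j => taylorCoeff10 F j * z ^ j) (F z) := by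
  have h := Complex.hasSum_taylorSeries_on_ball hF hz
  refine (hasSum_congr_aux fun j => ?_).mpr h
  rw [taylorCoeff10, sub_zero, smul_eq_mul, smul_eq_mul]
  field_simp

lemma tc_bound {F : ℂ → ℂ} {R : ℝ} (hR : 0 < R) (hF : DifferentiableOn ℂ F (closedBall (0:ℂ) R)) :
    ∃ C, 0 ≤ C ∧ ∀ j, ‖taylorCoeff10 F j‖ ≤ C * (R⁻¹) ^ j := by
  obtain ⟨C, hC⟩ := (isCompact_sphere (0:ℂ) R).exists_bound_of_continuousOn
    (hF.continuousOn.mono sphere_subset_closedBall)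
  refine ⟨|C|, abs_nonneg _, fun j => ?_⟩
  have h := norm_iteratedDeriv_le_of_forall_mem_sphere_norm_le j hR
    (hF.mono closure_ball_subset_closedBall).diffContOnCl (fun z hz => (hC z hz).trans (le_abs_self C))
  rw [taylorCoeff10, norm_div, norm_natCast, div_le_iff₀ (by positivity)]
  refine h.trans (le_of_eq ?_)
  rw [inv_pow]
  field_simp

lemma tc_shift {F : ℂ → ℂ} (hF : DifferentiableOn ℂ F (closedBall (0:ℂ) 1)) (j : ℕ) :
    taylorCoeff10 (fun w => w * F w) (j+1) = taylorCoeff10 F j := by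
  have h1 := tc_int one_pos hF j
  have h2 := tc_int (F := fun w => w * F w) one_pos (differentiableOn_id.mul hF) (j+1)
  simp only [ofReal_one, one_pow, mul_one, one_mul] at h1 h2
  rw [h1, h2]
  congr 2
  ext θ
  have := exp_ne_zero (θ * I)
  rw [inv_pow, inv_pow]
  field_simp
  ring

lemma H1_int {f : ℂ → ℂ} {M : ℝ} {e : ℝ → ℂ}
    (hdiff : DifferentiableOn ℂ f (ball (0:ℂ) 1))
    (hf : ∀ ρ : ℝ, 0 ≤ ρ → ρ < 1 →
      (1 / (2 * Real.pi)) *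
          ∫ θ in (0:ℝ)..(2 * Real.pi),
            ‖f ((ρ : ℂ) * Complex.exp (θ * Complex.I))‖ ≤ 1)
    (he : ∀ θ, ‖e θ‖ ≤ M) {ρ : ℝ} (h0 : 0 ≤ ρ) (h1 : ρ < 1) :
    ‖(1 / (2 * Real.pi : ℂ)) * ∫ θ in (0:ℝ)..(2 * Real.pi), f ((ρ:ℂ) * exp (θ * I)) * e θ‖ ≤ M := by
  have hM : 0 ≤ M := (norm_nonneg _).trans (he 0)
  have hcont : Continuous fun θ : ℝ => f ((ρ:ℂ) * exp (θ * I)) := by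
    refine hdiff.continuousOn.comp_continuous (by fun_prop) fun θ => ?_
    simp [Complex.norm_exp_ofReal_mul_I, abs_of_nonneg h0, h1]
  have h2 : ‖∫ θ in (0:ℝ)..(2 * Real.pi), f ((ρ:ℂ) * exp (θ * I)) * e θ‖
      ≤ ∫ θ in (0:ℝ)..(2 * Real.pi), ‖f ((ρ:ℂ) * exp (θ * I))‖ * M := by
    refine intervalIntegral.norm_integral_le_of_norm_le Real.two_pi_pos.le ?_ ?_
    · refine Eventually.of_forall fun θ _ => ?_
      rw [norm_mul]
      exact mul_le_mul_of_nonneg_left (he θ) (norm_nonneg _)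
    · exact (hcont.norm.mul continuous_const).intervalIntegrable _ _
  rw [intervalIntegral.integral_mul_const] at h2
  have h3 := hf ρ h0 h1
  have h4 : ‖(1 / (2 * Real.pi : ℂ))‖ = 1 / (2 * Real.pi) := by
    simp [Real.pi_pos.le]
  rw [norm_mul, h4]
  calc _ ≤ (1 / (2 * Real.pi)) * ((∫ θ in (0:ℝ)..(2 * Real.pi), ‖f ((ρ:ℂ) * exp (θ * I))‖) * M) := by
        gcongr
    _ = ((1 / (2 * Real.pi)) * ∫ θ in (0:ℝ)..(2 * Real.pi), ‖f ((ρ:ℂ) * exp (θ * I))‖) * M := by ring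
    _ ≤ 1 * M := by gcongr
    _ = M := one_mul M

lemma H1_coeff {f : ℂ → ℂ}
    (hdiff : DifferentiableOn ℂ f (ball (0:ℂ) 1))
    (hf : ∀ ρ : ℝ, 0 ≤ ρ → ρ < 1 →
      (1 / (2 * Real.pi)) *
          ∫ θ in (0:ℝ)..(2 * Real.pi),
            ‖f ((ρ : ℂ) * Complex.exp (θ * Complex.I))‖ ≤ 1) (j : ℕ) :
    ‖taylorCoeff10 f j‖ ≤ 1 := by
  have h1 : ∀ᶠ ρ : ℝ in 𝓝[<] 1, ‖taylorCoeff10 f j * (ρ:ℂ)^j‖ ≤ 1 := by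
    filter_upwards [Ioo_mem_nhdsLT (zero_lt_one' ℝ)] with ρ hρ
    rw [tc_int hρ.1 (hdiff.mono (closedBall_subset_ball hρ.2))]
    refine H1_int hdiff hf (fun θ => ?_) hρ.1.le hρ.2
    simp [Complex.norm_exp_ofReal_mul_I]
  have h2 : Tendsto (fun ρ : ℝ => ‖taylorCoeff10 f j * (ρ:ℂ)^j‖) (𝓝[<] 1)
      (𝓝 ‖taylorCoeff10 f j * ((1:ℝ):ℂ)^j‖) := by
    apply Tendsto.mono_left _ nhdsWithin_le_nhds
    exact Continuous.tendsto (by fun_prop) 1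
  simpa using le_of_tendsto h2 h1

lemma pair_summable {f e : ℂ → ℂ} {R : ℝ} (hR : 1 < R)
    (hc : ∀ j, ‖taylorCoeff10 f j‖ ≤ 1)
    (he : DifferentiableOn ℂ e (closedBall (0:ℂ) R)) :
    Summable (fun k => taylorCoeff10 f k * (starRingEnd ℂ) (taylorCoeff10 e k)) := by
  obtain ⟨C, hC0, hC⟩ := tc_bound (zero_lt_one.trans hR) he
  refine Summable.of_norm_bounded (g := fun j => C * (R⁻¹)^j)
    ((summable_geometric_of_lt_one (by positivity) (inv_lt_one_of_one_lt₀ hR)).mul_left C) fun j => ?_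
  rw [norm_mul, RCLike.norm_conj]
  calc _ ≤ 1 * ‖taylorCoeff10 e j‖ := by gcongr; exact hc j
    _ ≤ _ := by rw [one_mul]; exact hC j

lemma pair_bound {f e : ℂ → ℂ} {R M : ℝ} (hR : 1 < R)
    (hdiff : DifferentiableOn ℂ f (ball (0:ℂ) 1))
    (hf : ∀ ρ : ℝ, 0 ≤ ρ → ρ < 1 →
      (1 / (2 * Real.pi)) *
          ∫ θ in (0:ℝ)..(2 * Real.pi),
            ‖f ((ρ : ℂ) * Complex.exp (θ * Complex.I))‖ ≤ 1)
    (he : DifferentiableOn ℂ e (closedBall (0:ℂ) R))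
    (hM : ∀ w, ‖w‖ = 1 → ‖e w‖ ≤ M) : ‖cauchyPair10 f e‖ ≤ M := by
  obtain ⟨C, hC0, hC⟩ := tc_bound (zero_lt_one.trans hR) he
  have hgeo : Summable fun j : ℕ => C * (R⁻¹)^j :=
    (summable_geometric_of_lt_one (by positivity) (inv_lt_one_of_one_lt₀ hR)).mul_left C
  have hc := H1_coeff hdiff hf
  have h1 : ∀ᶠ ρ : ℝ in 𝓝[<] 1, ‖∑' j, (taylorCoeff10 f j * (ρ:ℂ)^j) * (starRingEnd ℂ) (taylorCoeff10 e j)‖ ≤ M := by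
    filter_upwards [Ioo_mem_nhdsLT (zero_lt_one' ℝ)] with ρ hρ
    have hcont : Continuous fun θ : ℝ => f ((ρ:ℂ) * exp (θ * I)) := by
      refine hdiff.continuousOn.comp_continuous (by fun_prop) fun θ => ?_
      simp [Complex.norm_exp_ofReal_mul_I, abs_of_nonneg hρ.1.le, hρ.2]
    have hinv : Continuous fun θ : ℝ => (exp (θ * I))⁻¹ :=
      Continuous.inv₀ (by fun_prop) fun θ => exp_ne_zero _
    have hs : HasSum (fun j => ∫ θ in (0:ℝ)..(2 * Real.pi),
          (f ((ρ:ℂ) * exp (θ * I)) * (exp (θ * I))⁻¹ ^ j) * (starRingEnd ℂ) (taylorCoeff10 e j))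
        (∫ θ in (0:ℝ)..(2 * Real.pi), f ((ρ:ℂ) * exp (θ * I)) * (starRingEnd ℂ) (e (exp (θ * I)))) := by
      refine intervalIntegral.hasSum_integral_of_dominated_convergence
        (fun j θ => ‖f ((ρ:ℂ) * exp (θ * I))‖ * (C * (R⁻¹)^j)) (fun j => ?_) (fun j => ?_) ?_ ?_ ?_
      · exact ((hcont.mul (hinv.pow j)).mul continuous_const).aestronglyMeasurable
      · refine Eventually.of_forall fun θ _ => ?_
        rw [norm_mul, norm_mul, RCLike.norm_conj, norm_pow, norm_inv, Complex.norm_exp_ofReal_mul_I]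
        simp only [inv_one, one_pow, mul_one]
        gcongr
        simpa using hC j
      · exact Eventually.of_forall fun θ _ => hgeo.mul_left _
      · simp_rw [tsum_mul_left]
        exact (hcont.norm.mul continuous_const).intervalIntegrable _ _
      · refine Eventually.of_forall fun θ _ => ?_
        have h5 : exp (θ * I) ∈ ball (0:ℂ) R := by
          simp [Complex.norm_exp_ofReal_mul_I, hR]
        have h6 := tc_hasSum (he.mono ball_subset_closedBall) h5
        have h7 := (h6.map (starRingEnd ℂ) continuous_conj).mul_left (f ((ρ:ℂ) * exp (θ * I)))
        refine (hasSum_congr_aux fun j => ?_).mpr h7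
        simp only [Function.comp, map_mul, map_pow]
        rw [← Complex.exp_neg, ← Complex.exp_conj]
        simp only [map_mul, conj_ofReal, conj_I, mul_neg]
        ring
    have h8 := (hs.mul_left (1 / (2 * Real.pi : ℂ))).tsum_eq
    have h9 : ∀ j, (taylorCoeff10 f j * (ρ:ℂ)^j) * (starRingEnd ℂ) (taylorCoeff10 e j)
        = (1 / (2 * Real.pi : ℂ)) * ∫ θ in (0:ℝ)..(2 * Real.pi),
          (f ((ρ:ℂ) * exp (θ * I)) * (exp (θ * I))⁻¹ ^ j) * (starRingEnd ℂ) (taylorCoeff10 e j) := by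
      intro j
      rw [tc_int hρ.1 (hdiff.mono (closedBall_subset_ball hρ.2)), intervalIntegral.integral_mul_const]
      ring
    simp_rw [h9]
    rw [h8]
    refine H1_int hdiff hf (fun θ => ?_) hρ.1.le hρ.2
    rw [RCLike.norm_conj]
    exact hM _ (Complex.norm_exp_ofReal_mul_I θ)
  have h2 : Tendsto (fun ρ : ℝ => ∑' j, (taylorCoeff10 f j * (ρ:ℂ)^j) * (starRingEnd ℂ) (taylorCoeff10 e j)) (𝓝[<] 1)
      (𝓝 (cauchyPair10 f e)) := by
    refine tendsto_tsum_of_dominated_convergence hgeo (fun j => ?_) ?_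
    · have : Tendsto (fun ρ : ℝ => (taylorCoeff10 f j * (ρ:ℂ)^j) * (starRingEnd ℂ) (taylorCoeff10 e j)) (𝓝 1)
        (𝓝 ((taylorCoeff10 f j * ((1:ℝ):ℂ)^j) * (starRingEnd ℂ) (taylorCoeff10 e j))) :=
        Continuous.tendsto (by fun_prop) 1
      simp only [ofReal_one, one_pow, mul_one] at this
      exact this.mono_left nhdsWithin_le_nhds
    · filter_upwards [Ioo_mem_nhdsLT (zero_lt_one' ℝ)] with ρ hρ j
      rw [norm_mul, norm_mul, RCLike.norm_conj, norm_pow, norm_real, Real.norm_of_nonneg hρ.1.le]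
      calc _ ≤ 1 * 1 * ‖taylorCoeff10 e j‖ := by
            gcongr
            · exact pow_nonneg hρ.1.le j
            · exact hc j
            · exact pow_le_one₀ hρ.1.le hρ.2.le
        _ ≤ _ := by simpa using hC j
  exact le_of_tendsto h2.norm h1


lemma den_ne {a w : ℂ} {r R : ℝ} (hr0 : 0 ≤ r) (hrR : r * R < 1) (ha : ‖a‖ ≤ r) (hw : ‖w‖ ≤ R) :
    1 - (starRingEnd ℂ) a * w ≠ 0 := by
  intro h
  have h1 : (starRingEnd ℂ) a * w = 1 := (sub_eq_zero.mp h).symm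
  have h2 : ‖a‖ * ‖w‖ = 1 := by
    rw [← RCLike.norm_conj a, ← norm_mul, h1, norm_one]
  have h3 : ‖a‖ * ‖w‖ ≤ r * R := by gcongr
  linarith

lemma blaschke_diff {a : ℂ} {r R : ℝ} (hr0 : 0 ≤ r) (hrR : r * R < 1) (ha : ‖a‖ ≤ r) :
    DifferentiableOn ℂ (blaschke10 a) (closedBall (0:ℂ) R) := by
  unfold blaschke10
  refine DifferentiableOn.div (by fun_prop) (by fun_prop) fun w hw => den_ne hr0 hrR ha (by simpa using hw)

lemma finBlaschke_diff {n : ℕ} {l : Fin n → ℂ} {r R : ℝ} (hr0 : 0 ≤ r) (hrR : r * R < 1) (hl : ∀ j, ‖l j‖ ≤ r) :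
    DifferentiableOn ℂ (finBlaschke10 n l) (closedBall (0:ℂ) R) := by
  unfold finBlaschke10
  exact DifferentiableOn.fun_finsetProd fun j _ => blaschke_diff hr0 hrR (hl j)

lemma malm_diff {n : ℕ} {l : Fin n → ℂ} {r R : ℝ} (hr0 : 0 ≤ r) (hrR : r * R < 1) (hl : ∀ j, ‖l j‖ ≤ r) (k : Fin n) :
    DifferentiableOn ℂ (malmquist10 n l k) (closedBall (0:ℂ) R) := by
  unfold malmquist10
  refine DifferentiableOn.mul (DifferentiableOn.fun_finsetProd fun j _ => blaschke_diff hr0 hrR (hl j)) ?_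
  exact DifferentiableOn.div (by fun_prop) (by fun_prop) fun w hw => den_ne hr0 hrR (hl k) (by simpa using hw)

lemma blaschke_le {a w : ℂ} (ha : ‖a‖ < 1) (hw : ‖w‖ ≤ 1) : ‖blaschke10 a w‖ ≤ 1 := by
  have hne : 1 - (starRingEnd ℂ) a * w ≠ 0 := den_ne (norm_nonneg a) (R := 1) (by simpa) le_rfl hw
  rw [blaschke10, norm_div, div_le_one (norm_pos_iff.mpr hne)]
  have h1 : ‖a‖ ^ 2 ≤ 1 := by nlinarith [norm_nonneg a]
  have h2 : ‖w‖ ^ 2 ≤ 1 := by nlinarith [norm_nonneg w]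
  refine (sq_le_sq₀ (norm_nonneg _) (norm_nonneg _)).mp ?_
  rw [Complex.sq_norm, Complex.normSq_apply] at h1 h2 ⊢
  rw [Complex.sq_norm, Complex.normSq_apply]
  simp only [sub_re, sub_im, one_re, one_im, mul_re, mul_im, conj_re, conj_im]
  nlinarith [mul_nonneg (sub_nonneg.mpr h1) (sub_nonneg.mpr h2)]

lemma malm_le {n : ℕ} {l : Fin n → ℂ} (hl : ∀ j, ‖l j‖ < 1) (k : Fin n) {w : ℂ} (hw : ‖w‖ ≤ 1) :
    ‖malmquist10 n l k w‖ ≤ Real.sqrt (1 - ‖l k‖^2) / (1 - ‖l k‖) := by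
  rw [malmquist10, norm_mul, norm_prod]
  have h1 : ∏ j ∈ Finset.univ.filter (fun j => j < k), ‖blaschke10 (l j) w‖ ≤ 1 :=
    Finset.prod_le_one (fun _ _ => norm_nonneg _) fun j _ => blaschke_le (hl j) hw
  have h2 : 1 - ‖l k‖ ≤ ‖1 - (starRingEnd ℂ) (l k) * w‖ := by
    have := norm_sub_norm_le (1:ℂ) ((starRingEnd ℂ) (l k) * w)
    rw [norm_one, norm_mul, RCLike.norm_conj] at this
    nlinarith [norm_nonneg (l k)]
  have h3 : 0 < 1 - ‖l k‖ := sub_pos.mpr (hl k)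
  rw [norm_div, norm_real, Real.norm_of_nonneg (Real.sqrt_nonneg _)]
  calc _ ≤ 1 * (Real.sqrt (1 - ‖l k‖^2) / ‖1 - (starRingEnd ℂ) (l k) * w‖) := by gcongr
    _ ≤ _ := by rw [one_mul]; gcongr

lemma malm_castSucc (n : ℕ) (l : Fin (n+1) → ℂ) (k : Fin n) (w : ℂ) :
    malmquist10 (n+1) l k.castSucc w = malmquist10 n (fun j => l j.castSucc) k w := by
  simp only [malmquist10, Finset.prod_filter]
  rw [Fin.prod_univ_castSucc]
  simp [Fin.castSucc_lt_castSucc_iff, (Fin.castSucc_lt_last k).le]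

lemma malm_last (n : ℕ) (l : Fin (n+1) → ℂ) (w : ℂ) :
    malmquist10 (n+1) l (Fin.last n) w = finBlaschke10 n (fun j => l j.castSucc) w *
    ((Real.sqrt (1 - ‖l (Fin.last n)‖ ^ 2) : ℂ) / (1 - (starRingEnd ℂ) (l (Fin.last n)) * w)) := by
  simp only [malmquist10, finBlaschke10, Finset.prod_filter]
  rw [Fin.prod_univ_castSucc]
  simp [Fin.castSucc_lt_last]

lemma kernel_id {r R : ℝ} (hr0 : 0 ≤ r) (hr : r < 1) (hrR : r * R < 1) {z w : ℂ} (hz : ‖z‖ ≤ 1) (hw : ‖w‖ ≤ R) :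
    ∀ (n : ℕ) (l : Fin n → ℂ) (hl : ∀ j, ‖l j‖ ≤ r),
    (1 - (starRingEnd ℂ) z * w) * ∑ k, (starRingEnd ℂ) (malmquist10 n l k z) * malmquist10 n l k w =
      1 - (starRingEnd ℂ) (finBlaschke10 n l z) * finBlaschke10 n l w := by
  intro n
  induction n with
  | zero => intro l hl; simp [finBlaschke10]
  | succ n ih =>
    intro l hl
    rw [Fin.sum_univ_castSucc, mul_add]
    simp only [malm_castSucc, malm_last]
    rw [ih (fun j => l j.castSucc) (fun j => hl _)]
    have hB : ∀ w, finBlaschke10 (n+1) l w = finBlaschke10 n (fun j => l j.castSucc) w * blaschke10 (l (Fin.last n)) w := by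
      intro w
      simp only [finBlaschke10, Fin.prod_univ_castSucc]
    rw [hB z, hB w]
    generalize finBlaschke10 n (fun j => l j.castSucc) z = P
    generalize finBlaschke10 n (fun j => l j.castSucc) w = Q
    have hal := hl (Fin.last n)
    generalize l (Fin.last n) = a at *
    have d1 : 1 - (starRingEnd ℂ) a * w ≠ 0 := den_ne hr0 hrR hal hw
    have d2 : 1 - (starRingEnd ℂ) a * z ≠ 0 := den_ne hr0 (R := 1) (by simpa) hal hz
    have d3 : 1 - a * (starRingEnd ℂ) z ≠ 0 := by
      intro h
      apply d2
      have := congrArg (starRingEnd ℂ) h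
      simpa using this
    have hs : ((Real.sqrt (1 - ‖a‖ ^ 2) : ℝ) : ℂ) ^ 2 = 1 - a * (starRingEnd ℂ) a := by
      rw [← ofReal_pow, Real.sq_sqrt (by nlinarith [norm_nonneg a]), mul_conj, Complex.normSq_eq_norm_sq]
      push_cast; ring
    simp only [blaschke10, map_mul, map_div₀, map_sub, map_one, conj_conj, conj_ofReal]
    generalize ((Real.sqrt (1 - ‖a‖ ^ 2) : ℝ) : ℂ) = s at *
    generalize (starRingEnd ℂ) a = a' at *
    generalize (starRingEnd ℂ) z = z' at *
    generalize (starRingEnd ℂ) P = P' at *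
    have hu := mul_inv_cancel₀ d1
    have hv := mul_inv_cancel₀ d3
    simp only [div_eq_mul_inv]
    generalize (1 - a' * w)⁻¹ = u at *
    generalize (1 - a * z')⁻¹ = v at *
    linear_combination (P' * Q * u * v * (1 - z' * w)) * hs + P' * Q * (v * (1 - a * z') * hu + hv)

lemma tc_congr {F G : ℂ → ℂ} (h : F =ᶠ[𝓝 0] G) (j : ℕ) : taylorCoeff10 F j = taylorCoeff10 G j := by
  rw [taylorCoeff10, taylorCoeff10, h.iteratedDeriv_eq]

lemma tc_sum {ι : Type*} (s : Finset ι) {F : ι → ℂ → ℂ} (hF : ∀ i ∈ s, AnalyticAt ℂ (F i) 0) (c : ι → ℂ) (j : ℕ) :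
    taylorCoeff10 (fun w => ∑ i ∈ s, c i * F i w) j = ∑ i ∈ s, c i * taylorCoeff10 (F i) j := by
  simp only [taylorCoeff10]
  rw [iteratedDeriv_fun_sum (fun i hi => (analyticAt_const.fun_mul (hF i hi)).contDiffAt), Finset.sum_div]
  refine Finset.sum_congr rfl fun i hi => ?_
  rw [iteratedDeriv_const_mul_field, mul_div_assoc]

lemma tc_sub_mul {F G : ℂ → ℂ} (hF : AnalyticAt ℂ F 0) (hG : AnalyticAt ℂ G 0) (c : ℂ) (j : ℕ) :
    taylorCoeff10 (fun w => F w - c * G w) j = taylorCoeff10 F j - c * taylorCoeff10 G j := by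
  simp only [taylorCoeff10]
  rw [iteratedDeriv_fun_sub hF.contDiffAt (analyticAt_const.fun_mul hG).contDiffAt,
    iteratedDeriv_const_mul_field, sub_div, mul_div_assoc]

/-- Horner type partial sums of the conjugated Taylor coefficients `b`. -/
noncomputable def hornerAux (b : ℕ → ℂ) : ℕ → ℂ → ℂ
  | 0, _ => (starRingEnd ℂ) (b 0)
  | j + 1, z => z * hornerAux b j z + (starRingEnd ℂ) (b (j + 1))

lemma horner_diff (b : ℕ → ℂ) (j : ℕ) : Differentiable ℂ (hornerAux b j) := by
  induction j with
  | zero => exact differentiable_const _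
  | succ j ih => exact (differentiable_id.mul ih).add (differentiable_const _)

lemma horner_bound {b : ℕ → ℂ} {C s : ℝ} (hC : 0 ≤ C) (hs : 0 ≤ s) (hb : ∀ j, ‖b j‖ ≤ C * s ^ j)
    {z : ℂ} (hz : ‖z‖ ≤ s) (j : ℕ) : ‖hornerAux b j z‖ ≤ C * ((j + 1 : ℝ) * s ^ j) := by
  induction j with
  | zero => simpa [hornerAux] using hb 0
  | succ j ih =>
    rw [hornerAux]
    refine (norm_add_le _ _).trans ?_
    rw [norm_mul, RCLike.norm_conj]
    calc _ ≤ s * (C * ((j + 1 : ℝ) * s ^ j)) + C * s ^ (j+1) := by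
          gcongr
          exact hb _
      _ = _ := by push_cast; ring

lemma horner_summable (C : ℝ) {s : ℝ} (hs : 0 ≤ s) (hs1 : s < 1) :
    Summable fun j : ℕ => C * ((j + 1 : ℝ) * s ^ j) := by
  refine Summable.mul_left C ?_
  have h1 := summable_pow_mul_geometric_of_norm_lt_one 1 (r := s) (by rwa [Real.norm_of_nonneg hs])
  have h2 := summable_geometric_of_lt_one hs hs1
  refine (h1.add h2).congr fun j => ?_
  ring

lemma coeff_id {n : ℕ} {l : Fin n → ℂ} {r R : ℝ} (hr0 : 0 ≤ r) (hr : r < 1) (hR : 1 < R) (hrR : r * R < 1)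
    (hl : ∀ j, ‖l j‖ ≤ r) {z : ℂ} (hz : ‖z‖ ≤ 1) (j : ℕ) :
    ∑ k, (starRingEnd ℂ) (taylorCoeff10 (malmquist10 n l k) j) * malmquist10 n l k z =
      z ^ j - finBlaschke10 n l z * hornerAux (taylorCoeff10 (finBlaschke10 n l)) j z := by
  have hR0 : closedBall (0:ℂ) R ∈ 𝓝 (0:ℂ) := closedBall_mem_nhds _ (by linarith)
  have hme : ∀ k, AnalyticAt ℂ (malmquist10 n l k) 0 := fun k =>
    (malm_diff hr0 hrR hl k).analyticAt hR0
  have hBe : AnalyticAt ℂ (finBlaschke10 n l) 0 := (finBlaschke_diff hr0 hrR hl).analyticAt hR0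
  set F : ℂ → ℂ := fun w => ∑ k, (starRingEnd ℂ) (malmquist10 n l k z) * malmquist10 n l k w with hFdef
  have hFd : DifferentiableOn ℂ F (closedBall (0:ℂ) R) := by
    exact DifferentiableOn.fun_sum fun k _ => (malm_diff hr0 hrR hl k).const_mul _
  have hFa : AnalyticAt ℂ F 0 := hFd.analyticAt hR0
  have hF1 : DifferentiableOn ℂ F (closedBall (0:ℂ) 1) := hFd.mono (closedBall_subset_closedBall hR.le)
  have hcF : ∀ j, taylorCoeff10 F j = ∑ k, (starRingEnd ℂ) (malmquist10 n l k z) * taylorCoeff10 (malmquist10 n l k) j :=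
    fun j => tc_sum _ (fun k _ => hme k) _ j
  have hEq : (fun w => F w - (starRingEnd ℂ) z * (w * F w)) =ᶠ[𝓝 0]
      (fun w => 1 - (starRingEnd ℂ) (finBlaschke10 n l z) * finBlaschke10 n l w) := by
    filter_upwards [hR0] with w hw
    have := kernel_id hr0 hr hrR hz (by simpa using hw) n l hl (w := w)
    rw [← this, hFdef]; ring
  have hrec : ∀ j, taylorCoeff10 F j - (starRingEnd ℂ) z * taylorCoeff10 (fun w => w * F w) j =
      taylorCoeff10 (fun _ => 1) j - (starRingEnd ℂ) (finBlaschke10 n l z) * taylorCoeff10 (finBlaschke10 n l) j := by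
    intro j
    rw [← tc_sub_mul hFa (G := fun w => w * F w) (analyticAt_id.fun_mul hFa), ← tc_sub_mul analyticAt_const hBe]
    exact tc_congr hEq j
  have key : (starRingEnd ℂ) (taylorCoeff10 F j) =
      z ^ j - finBlaschke10 n l z * hornerAux (taylorCoeff10 (finBlaschke10 n l)) j z := by
    induction j with
    | zero =>
      have h := congrArg (starRingEnd ℂ) (hrec 0)
      have h1 : taylorCoeff10 (fun w => w * F w) 0 = 0 := by simp [taylorCoeff10]
      have h2 : taylorCoeff10 (fun _ => (1:ℂ)) 0 = 1 := by simp [taylorCoeff10]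
      rw [h1, h2] at h
      simp only [mul_zero, sub_zero, map_sub, map_mul, map_one, conj_conj] at h
      rw [h, hornerAux, pow_zero]
    | succ j ih =>
      have h := congrArg (starRingEnd ℂ) (hrec (j+1))
      have h2 : taylorCoeff10 (fun _ => (1:ℂ)) (j+1) = 0 := by
        simp [taylorCoeff10, iteratedDeriv_const]
      rw [tc_shift hF1, h2] at h
      simp only [map_zero, map_sub, map_mul, conj_conj] at h
      rw [ih] at h
      rw [hornerAux]
      linear_combination h
  rw [← key, hcF, map_sum]
  refine Finset.sum_congr rfl fun k _ => ?_
  rw [map_mul, conj_conj, mul_comm]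

theorem stmt_10 (n : ℕ) (l : Fin n → ℂ) (r : ℝ) (hr0 : 0 ≤ r) (hr : r < 1)
    (hl : ∀ j, ‖l j‖ ≤ r) (f : ℂ → ℂ)
    (hdiff : DifferentiableOn ℂ f (ball (0:ℂ) 1))
    (hf : ∀ ρ : ℝ, 0 ≤ ρ → ρ < 1 →
      (1 / (2 * Real.pi)) *
          ∫ θ in (0:ℝ)..(2 * Real.pi),
            ‖f ((ρ : ℂ) * Complex.exp (θ * Complex.I))‖ ≤ 1) :
    (∀ z ∈ ball (0:ℂ) 1,
        ‖∑ k, cauchyPair10 f (malmquist10 n l k) * malmquist10 n l k z‖ ≤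
          2 * n / (1 - r)) ∧
    ∃ h : ℂ → ℂ, DifferentiableOn ℂ h (ball (0:ℂ) 1) ∧
      ∀ z ∈ ball (0:ℂ) 1,
        (∑ k, cauchyPair10 f (malmquist10 n l k) * malmquist10 n l k z) - f z =
          finBlaschke10 n l z * h z := by
  obtain ⟨R, hR, hrR⟩ : ∃ R : ℝ, 1 < R ∧ r * R < 1 := by
    refine ⟨2 / (1 + r), ?_, ?_⟩
    · rw [lt_div_iff₀ (by linarith)]; linarith
    · rw [mul_div_assoc', div_lt_one (by linarith)]; linarith
  have hR0 : 0 < R := by linarith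
  have hl1 : ∀ j, ‖l j‖ < 1 := fun j => (hl j).trans_lt hr
  have hc := H1_coeff hdiff hf
  constructor
  · intro z hz
    have hz1 : ‖z‖ ≤ 1 := by simpa using (mem_ball_zero_iff.mp hz).le
    have hterm : ∀ k : Fin n, ‖cauchyPair10 f (malmquist10 n l k) * malmquist10 n l k z‖ ≤ 2 / (1 - r) := by
      intro k
      have h1 := pair_bound hR hdiff hf (malm_diff hr0 hrR hl k) (fun w hw => malm_le hl1 k hw.le)
      have h2 := malm_le hl1 k hz1
      have h0 := (norm_nonneg _).trans h1
      have ha := hl k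
      have ha0 := norm_nonneg (l k)
      have h3 : 0 < 1 - ‖l k‖ := sub_pos.mpr (hl1 k)
      rw [norm_mul]
      refine (mul_le_mul h1 h2 (norm_nonneg _) h0).trans ?_
      rw [div_mul_div_comm, Real.mul_self_sqrt (by nlinarith), div_le_div_iff₀ (by positivity) (by linarith)]
      have : (1 + ‖l k‖) * (1 - r) ≤ 2 * (1 - ‖l k‖) := by nlinarith
      nlinarith
    calc _ ≤ ∑ k : Fin n, 2 / (1 - r) := norm_sum_le_of_le _ fun k _ => hterm k
      _ = _ := by simp; ring
  · obtain ⟨C, hC0, hC⟩ := tc_bound hR0 (finBlaschke_diff hr0 hrR hl)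
    set b := taylorCoeff10 (finBlaschke10 n l) with hb
    have hbd : ∀ t : ℝ, 0 ≤ t → t < 1 → ∃ u : ℕ → ℝ, Summable u ∧
        ∀ j (z : ℂ), ‖z‖ ≤ t → ‖taylorCoeff10 f j * hornerAux b j z‖ ≤ u j := by
      intro t ht0 ht1
      have hRi : R⁻¹ < 1 := inv_lt_one_of_one_lt₀ hR
      have hs0 : 0 ≤ max t R⁻¹ := le_max_of_le_left ht0
      refine ⟨_, horner_summable C hs0 (max_lt ht1 hRi), fun j z hz => ?_⟩
      have hb' : ∀ j, ‖b j‖ ≤ C * (max t R⁻¹) ^ j := fun j => (hC j).trans (by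
        have : R⁻¹ ≤ max t R⁻¹ := le_max_right _ _
        gcongr)
      have h := horner_bound hC0 hs0 hb' (hz.trans (le_max_left _ _)) j
      rw [norm_mul]
      calc _ ≤ 1 * ‖hornerAux b j z‖ := by gcongr; exact hc j
        _ ≤ _ := by rw [one_mul]; exact h
    refine ⟨fun z => -∑' j, taylorCoeff10 f j * hornerAux b j z, ?_, ?_⟩
    · intro z hz
      obtain ⟨t, hzt, ht1⟩ := exists_between (mem_ball_zero_iff.mp hz)
      have ht0 : 0 ≤ t := (norm_nonneg z).trans hzt.le
      obtain ⟨u, hu, hle⟩ := hbd t ht0 ht1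
      have h := differentiableOn_tsum_of_summable_norm (F := fun j z => taylorCoeff10 f j * hornerAux b j z)
        (U := ball (0:ℂ) t) hu
        (fun j => ((horner_diff b j).const_mul _).differentiableOn) isOpen_ball
        (fun j w hw => hle j w (mem_ball_zero_iff.mp hw).le)
      exact (h.differentiableAt (isOpen_ball.mem_nhds (mem_ball_zero_iff.mpr hzt))).neg.differentiableWithinAt
    · intro z hz
      have hz1 := mem_ball_zero_iff.mp hz
      obtain ⟨u, hu, hle⟩ := hbd ‖z‖ (norm_nonneg z) hz1
      have hS : Summable fun j => taylorCoeff10 f j * hornerAux b j z :=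
        Summable.of_norm_bounded hu fun j => hle j z le_rfl
      have h1 := tc_hasSum hdiff hz
      have h2 := h1.sub (hS.hasSum.mul_left (finBlaschke10 n l z))
      have h3 : HasSum (fun j => ∑ k, taylorCoeff10 f j *
          (starRingEnd ℂ) (taylorCoeff10 (malmquist10 n l k) j) * malmquist10 n l k z)
          (∑ k, cauchyPair10 f (malmquist10 n l k) * malmquist10 n l k z) :=
        hasSum_sum fun k _ => ((pair_summable hR hc (malm_diff hr0 hrR hl k)).hasSum).mul_right _
      have h4 : ∀ j, ∑ k, taylorCoeff10 f j *
          (starRingEnd ℂ) (taylorCoeff10 (malmquist10 n l k) j) * malmquist10 n l k z =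
          taylorCoeff10 f j * z ^ j - finBlaschke10 n l z * (taylorCoeff10 f j * hornerAux b j z) := by
        intro j
        simp_rw [mul_assoc]
        rw [← Finset.mul_sum, coeff_id hr0 hr hR hrR hl hz1.le]
        ring
      have h5 := h3.unique ((hasSum_congr_aux h4).mpr h2)
      rw [h5]
      ring
end
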